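/- Let V be a finite-dimensional complex vector space, e ∈ V, U ⊆ ℂ^r an open neighborhood of 0, and Ω₁,…,Ω_r : U → End(V) holomorphic maps satisfying, for all a, b and all q ∈ U: q_a ∂Ω_b/∂q_a = q_b ∂Ω_a/∂q_b and Ω_a(q)Ω_b(q) = Ω_b(q)Ω_a(q). Assume V is spanned by the vectors p_{a₁}p_{a₂}⋯p_{a_k}(e) over all k ≥ 0 and all indices a₁,…,a_k ∈ {1,…,r}, where p_a := Ω_a(0). Then for any vectors v₁,…,v_l ∈ V there exist an open neighborhood U' of 0 in ℂ^{r+l} and holomorphic maps Ω̃₁,…,Ω̃_r, Φ₁,…,Φ_l : U' → End(V) such that: Ω̃_a(q,0) = Ω_a(q); Φ_j(q,t)e = v_j for all (q,t) ∈ U'; all the endomorphisms Ω̃_a(q,t), Φ_j(q,t) commute pairwise; and ∂Ω̃_a/∂t_j = q_a ∂Φ_j/∂q_a, q_a ∂Ω̃_b/∂q_a = q_b ∂Ω̃_a/∂q_b, ∂Φ_k/∂t_j = ∂Φ_j/∂t_k on U'. Moreover this extension is unique as a germ at 0: any two such collections agree on a neighborhood of 0. -/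

import Mathlib

open scoped BigOperators

/-- The data `(U', Ω̃, Φ)` is a flat extension of the flat pencil of connections
`ℏ d + ∑_a Ω_a dq_a/q_a` on `U ∋ 0` in the directions `t₁, …, t_l`, with
`Φ_j(unit) = v_j`: `U'` is an open neighborhood of `0` in `ℂ^r × ℂ^l` lying over `U`, the
matrices `Ω̃_a, Φ_j` are holomorphic on `U'`, restrict to `Ω_a` on `t = 0`, commute pairwise,
satisfy `Φ_j e = v_j`, and obey the flatness equations
`∂Ω̃_a/∂t_j = q_a ∂Φ_j/∂q_a`, `q_a ∂Ω̃_b/∂q_a = q_b ∂Ω̃_a/∂q_b`, `∂Φ_k/∂t_j = ∂Φ_j/∂t_k`. -/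
def IsFlatExtension (r l : ℕ) (V : Type*) [NormedAddCommGroup V] [NormedSpace ℂ V]
    (e : V) (v : Fin l → V) (U : Set (Fin r → ℂ))
    (Ω : Fin r → (Fin r → ℂ) → (V →L[ℂ] V))
    (U' : Set ((Fin r → ℂ) × (Fin l → ℂ)))
    (Ωt : Fin r → ((Fin r → ℂ) × (Fin l → ℂ)) → (V →L[ℂ] V))
    (Φ : Fin l → ((Fin r → ℂ) × (Fin l → ℂ)) → (V →L[ℂ] V)) : Prop :=
  IsOpen U' ∧ ((0 : Fin r → ℂ), (0 : Fin l → ℂ)) ∈ U' ∧ (∀ p ∈ U', p.1 ∈ U) ∧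
  (∀ a, DifferentiableOn ℂ (Ωt a) U') ∧ (∀ j, DifferentiableOn ℂ (Φ j) U') ∧
  (∀ a, ∀ q : Fin r → ℂ, (q, (0 : Fin l → ℂ)) ∈ U' → Ωt a (q, 0) = Ω a q) ∧
  (∀ j, ∀ p ∈ U', Φ j p e = v j) ∧
  (∀ a b, ∀ p ∈ U', Ωt a p * Ωt b p = Ωt b p * Ωt a p) ∧
  (∀ a j, ∀ p ∈ U', Ωt a p * Φ j p = Φ j p * Ωt a p) ∧
  (∀ j k, ∀ p ∈ U', Φ j p * Φ k p = Φ k p * Φ j p) ∧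
  (∀ a j, ∀ p ∈ U',
    fderiv ℂ (Ωt a) p ((0 : Fin r → ℂ), Pi.single j 1)
      = p.1 a • fderiv ℂ (Φ j) p (Pi.single a 1, (0 : Fin l → ℂ))) ∧
  (∀ a b, ∀ p ∈ U',
    p.1 a • fderiv ℂ (Ωt b) p (Pi.single a 1, (0 : Fin l → ℂ))
      = p.1 b • fderiv ℂ (Ωt a) p (Pi.single b 1, (0 : Fin l → ℂ))) ∧
  (∀ j k, ∀ p ∈ U',
    fderiv ℂ (Φ k) p ((0 : Fin r → ℂ), Pi.single j 1)
      = fderiv ℂ (Φ j) p ((0 : Fin r → ℂ), Pi.single k 1))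

section aux_proof

open Filter Topology Asymptotics

set_option linter.unusedSectionVars false
set_option linter.unusedSimpArgs false




/-- A submultiplicative positive weight on exponents. -/
structure FWt (σ : Type) where
  w : (σ →₀ ℕ) → ℝ
  pos : ∀ n, 0 < w n
  zero : w 0 = 1
  mul : ∀ m n, w (m + n) ≤ w m * w n

section banach

variable {σ : Type} {R : Type*} [NormedRing R] [NormedAlgebra ℂ R]

theorem FWt.conv_summable (W : FWt σ) (F G : MvPowerSeries σ R)
    (hF : Summable fun n => ‖MvPowerSeries.coeff n F‖ * W.w n)
    (hG : Summable fun n => ‖MvPowerSeries.coeff n G‖ * W.w n) :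
    (Summable fun n => ‖MvPowerSeries.coeff n (F * G)‖ * W.w n) ∧
    ∑' n, ‖MvPowerSeries.coeff n (F * G)‖ * W.w n ≤
      (∑' n, ‖MvPowerSeries.coeff n F‖ * W.w n) * ∑' n, ‖MvPowerSeries.coeff n G‖ * W.w n := by
  classical
  set f := fun n => ‖MvPowerSeries.coeff n F‖ * W.w n with hf
  set g := fun n => ‖MvPowerSeries.coeff n G‖ * W.w n with hg
  have hf0 : ∀ n, 0 ≤ f n := fun n => mul_nonneg (norm_nonneg _) (W.pos n).le
  have hg0 : ∀ n, 0 ≤ g n := fun n => mul_nonneg (norm_nonneg _) (W.pos n).le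
  have hfg := hF.mul_of_nonneg hG hf0 hg0
  have hs := summable_sum_mul_antidiagonal_of_summable_mul hfg
  have hle : ∀ n, ‖MvPowerSeries.coeff n (F * G)‖ * W.w n ≤
      ∑ kl ∈ Finset.HasAntidiagonal.antidiagonal n, f kl.1 * g kl.2 := by
    intro n
    rw [MvPowerSeries.coeff_mul]
    calc _ ≤ (∑ kl ∈ Finset.HasAntidiagonal.antidiagonal n, ‖MvPowerSeries.coeff kl.1 F * MvPowerSeries.coeff kl.2 G‖) * W.w n :=
          mul_le_mul_of_nonneg_right (norm_sum_le _ _) (W.pos n).le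
      _ = ∑ kl ∈ Finset.HasAntidiagonal.antidiagonal n, ‖MvPowerSeries.coeff kl.1 F * MvPowerSeries.coeff kl.2 G‖ * W.w n := by
          rw [Finset.sum_mul]
      _ ≤ _ := by
          refine Finset.sum_le_sum fun kl hkl => ?_
          rw [Finset.HasAntidiagonal.mem_antidiagonal] at hkl
          rw [← hkl]
          calc _ ≤ (‖MvPowerSeries.coeff kl.1 F‖ * ‖MvPowerSeries.coeff kl.2 G‖) * (W.w kl.1 * W.w kl.2) :=
                mul_le_mul (norm_mul_le _ _) (W.mul _ _) (W.pos _).le (by positivity)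
            _ = _ := by simp only [hf, hg]; ring
  have h1 : Summable fun n => ‖MvPowerSeries.coeff n (F * G)‖ * W.w n :=
    Summable.of_nonneg_of_le (fun n => mul_nonneg (norm_nonneg _) (W.pos n).le) hle hs
  refine ⟨h1, ?_⟩
  rw [hF.tsum_mul_tsum_eq_tsum_sum_antidiagonal hG hfg]
  exact h1.tsum_le_tsum hle hs

theorem FWt.C_summable (W : FWt σ) (a : R) :
    HasSum (fun n => ‖MvPowerSeries.coeff n (MvPowerSeries.C a : MvPowerSeries σ R)‖ * W.w n) ‖a‖ := by
  classical
  convert hasSum_ite_eq (0 : σ →₀ ℕ) ‖a‖ using 2 with n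
  rw [MvPowerSeries.coeff_C]
  split_ifs with h
  · simp [h, W.zero]
  · simp

/-- Weighted absolutely summable power series. -/
def FWt.sub (W : FWt σ) (R : Type*) [NormedRing R] [NormedAlgebra ℂ R] :
    Subalgebra ℂ (MvPowerSeries σ R) where
  carrier := {F | Summable fun n => ‖MvPowerSeries.coeff n F‖ * W.w n}
  mul_mem' := fun {F G} hF hG => (W.conv_summable F G hF hG).1
  add_mem' := fun {F G} hF hG => by
    refine Summable.of_nonneg_of_le (fun n => mul_nonneg (norm_nonneg _) (W.pos n).le)
      (fun n => ?_) (Summable.add hF hG)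
    rw [map_add, ← add_mul]
    exact mul_le_mul_of_nonneg_right (norm_add_le _ _) (W.pos n).le
  algebraMap_mem' := fun c => by
    rw [MvPowerSeries.algebraMap_apply]
    exact (W.C_summable _).summable

/-- The Banach algebra. -/
def FWA (W : FWt σ) (R : Type*) [NormedRing R] [NormedAlgebra ℂ R] : Type _ := ↥(W.sub R)

variable (W : FWt σ)

noncomputable instance : Ring (FWA W R) := inferInstanceAs (Ring ↥(W.sub R))
noncomputable instance : Algebra ℂ (FWA W R) := inferInstanceAs (Algebra ℂ ↥(W.sub R))

variable {W}

/-- coefficient -/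
def FWA.co (x : FWA W R) (n : σ →₀ ℕ) : R := MvPowerSeries.coeff n x.1

theorem FWA.ext' {x y : FWA W R} (h : ∀ n, x.co n = y.co n) : x = y :=
  Subtype.ext (MvPowerSeries.ext h)

theorem FWA.sm (x : FWA W R) : Summable fun n => ‖x.co n‖ * W.w n := x.2

@[simp] theorem FWA.co_add (x y : FWA W R) (n) : (x + y).co n = x.co n + y.co n := rfl
@[simp] theorem FWA.co_sub (x y : FWA W R) (n) : (x - y).co n = x.co n - y.co n := rfl
@[simp] theorem FWA.co_neg (x : FWA W R) (n) : (-x).co n = - x.co n := rfl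
@[simp] theorem FWA.co_zero (n) : (0 : FWA W R).co n = 0 := rfl
@[simp] theorem FWA.co_smul (c : ℂ) (x : FWA W R) (n) : (c • x).co n = c • x.co n := rfl

/-- build an element from coefficients -/
def FWA.mk' (f : (σ →₀ ℕ) → R) (h : Summable fun n => ‖f n‖ * W.w n) : FWA W R := ⟨f, h⟩

@[simp] theorem FWA.co_mk' (f : (σ →₀ ℕ) → R) (h : Summable fun n => ‖f n‖ * W.w n) (n) :
    (FWA.mk' f h).co n = f n := rfl

theorem FWA.co_mul [DecidableEq σ] (x y : FWA W R) (n) :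
    (x * y).co n = ∑ p ∈ Finset.HasAntidiagonal.antidiagonal n, x.co p.1 * y.co p.2 :=
  MvPowerSeries.coeff_mul n x.1 y.1

noncomputable instance : Norm (FWA W R) := ⟨fun x => ∑' n, ‖x.co n‖ * W.w n⟩

theorem FWA.norm_def (x : FWA W R) : ‖x‖ = ∑' n, ‖x.co n‖ * W.w n := rfl

noncomputable instance : NormedAddCommGroup (FWA W R) :=
  NormedAddCommGroup.ofCore (𝕜 := ℂ)
  { norm_nonneg := fun x => tsum_nonneg fun n => mul_nonneg (norm_nonneg _) (W.pos n).le
    norm_smul := fun c x => by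
      simp only [FWA.norm_def, FWA.co_smul, norm_smul, mul_assoc, tsum_mul_left]
    norm_triangle := fun x y => by
      simp only [FWA.norm_def]
      rw [← x.sm.tsum_add y.sm]
      refine (x + y).sm.tsum_le_tsum (fun n => ?_) (x.sm.add y.sm)
      rw [← add_mul]
      exact mul_le_mul_of_nonneg_right (norm_add_le _ _) (W.pos n).le
    norm_eq_zero_iff := fun x => by
      constructor
      · intro h
        have := (hasSum_zero_iff_of_nonneg
          (fun n => mul_nonneg (norm_nonneg (x.co n)) (W.pos n).le)).1 (by
            have h3 := x.sm.hasSum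
            rw [← FWA.norm_def, h] at h3
            exact h3)
        apply FWA.ext'
        intro n
        have h2 := congrFun this n
        simpa [(W.pos n).ne'] using h2
      · rintro rfl
        simp [FWA.norm_def] }

noncomputable instance : NormedRing (FWA W R) :=
  { (inferInstance : Ring (FWA W R)), (inferInstance : NormedAddCommGroup (FWA W R)) with
    norm_mul_le := fun x y => (W.conv_summable x.1 y.1 x.2 y.2).2 }

noncomputable instance : NormedAlgebra ℂ (FWA W R) :=
  { (inferInstance : Algebra ℂ (FWA W R)) with
    norm_smul_le := fun c x => by
      simp only [FWA.norm_def, FWA.co_smul, norm_smul, mul_assoc, tsum_mul_left]; exact le_rfl }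

/-- comparison with `lp` -/
noncomputable def FWA.toLp (W : FWt σ) : FWA W R ≃ᵢ lp (fun _ : σ →₀ ℕ => R) 1 where
  toFun x := ⟨fun n => (W.w n : ℂ) • x.co n, by
    refine memℓp_gen ?_
    simpa [norm_smul, abs_of_pos (W.pos _), mul_comm] using x.sm⟩
  invFun f := FWA.mk' (fun n => ((W.w n)⁻¹ : ℂ) • f n) (by
    have := (memℓp_gen_iff (by simp)).1 (lp.memℓp f)
    convert this using 2 with n
    have := (W.pos n).ne'
    simp only [norm_smul, norm_inv, Complex.norm_real, Real.norm_eq_abs, abs_of_pos (W.pos n)]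
    simp
    field_simp)
  left_inv x := by
    apply FWA.ext'; intro n
    have : (W.w n : ℂ) ≠ 0 := by exact_mod_cast (W.pos n).ne'
    exact inv_smul_smul₀ this _
  right_inv f := by
    ext n
    have : (W.w n : ℂ) ≠ 0 := by exact_mod_cast (W.pos n).ne'
    simp [smul_smul, this]
  isometry_toFun := by
    refine Isometry.of_dist_eq fun x y => ?_
    rw [dist_eq_norm, dist_eq_norm, lp.norm_eq_tsum_rpow (by simp), FWA.norm_def]
    simp only [ENNReal.toReal_one, Real.rpow_one, div_one]
    refine tsum_congr fun n => ?_
    change ‖(W.w n : ℂ) • x.co n - (W.w n : ℂ) • y.co n‖ = ‖x.co n - y.co n‖ * W.w n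
    rw [← smul_sub, norm_smul, Complex.norm_real, Real.norm_eq_abs, abs_of_pos (W.pos _), mul_comm]

instance [CompleteSpace R] : CompleteSpace (FWA W R) := (FWA.toLp W).completeSpace

/-- constants -/
noncomputable def FWA.C : R →+* FWA W R where
  toFun a := ⟨MvPowerSeries.C a, (W.C_summable a).summable⟩
  map_one' := Subtype.ext (map_one _)
  map_mul' a b := Subtype.ext (map_mul _ a b)
  map_zero' := Subtype.ext (map_zero _)
  map_add' a b := Subtype.ext (map_add _ a b)

theorem FWA.co_C [DecidableEq σ] (a : R) (n) : (FWA.C a : FWA W R).co n = if n = 0 then a else 0 :=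
  MvPowerSeries.coeff_C n a

theorem FWA.norm_C (a : R) : ‖(FWA.C a : FWA W R)‖ = ‖a‖ := (W.C_summable a).tsum_eq

theorem FWA.continuous_C : Continuous (FWA.C : R → FWA W R) := by
  refine Metric.continuous_iff.2 fun b ε hε => ⟨ε, hε, fun a h => ?_⟩
  rw [dist_eq_norm] at *
  rwa [← map_sub, FWA.norm_C]

end banach




section tsumC

theorem fce_fderiv_bound {E F : Type*} [NormedAddCommGroup E] [NormedSpace ℂ E]
    [NormedAddCommGroup F] [NormedSpace ℂ F] {f : E → F} {x : E} {ρ M : ℝ} (hρ : 0 < ρ)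
    (hf : DifferentiableOn ℂ f (Metric.ball x ρ)) (hM : ∀ y ∈ Metric.ball x ρ, ‖f y‖ ≤ M) :
    ‖fderiv ℂ f x‖ ≤ 2 * M / ρ := by
  refine Complex.norm_fderiv_le_div_of_mapsTo_ball hf (fun y hy => ?_) hρ
  rw [Metric.mem_closedBall, dist_eq_norm]
  have := norm_sub_le (f y) (f x)
  have := hM y hy
  have := hM x (Metric.mem_ball_self hρ)
  linarith

theorem fce_tsum_hasFDerivAt {ι E F : Type*} [NormedAddCommGroup E] [NormedSpace ℂ E]
    [NormedAddCommGroup F] [NormedSpace ℂ F] [CompleteSpace F] {f : ι → E → F} {x : E}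
    {ρ : ℝ} {M : ι → ℝ} (hρ : 0 < ρ) (hM : Summable M) (hf : ∀ i, Differentiable ℂ (f i))
    (hb : ∀ i, ∀ y ∈ Metric.ball x ρ, ‖f i y‖ ≤ M i) :
    (∀ i, ∀ y ∈ Metric.ball x (ρ/2), ‖fderiv ℂ (f i) y‖ ≤ 2 * M i / (ρ/2)) ∧
    ∀ y ∈ Metric.ball x (ρ/2),
      HasFDerivAt (fun y => ∑' i, f i y) (∑' i, fderiv ℂ (f i) y) y := by
  have h1 : ∀ i, ∀ y ∈ Metric.ball x (ρ/2), ‖fderiv ℂ (f i) y‖ ≤ 2 * M i / (ρ/2) := by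
    intro i y hy
    refine fce_fderiv_bound (half_pos hρ) (hf i).differentiableOn fun z hz => hb i z ?_
    rw [Metric.mem_ball] at *
    linarith [dist_triangle z y x]
  refine ⟨h1, fun y hy => ?_⟩
  refine hasFDerivAt_tsum_of_isPreconnected (s := Metric.ball x (ρ/2)) (x₀ := x)
    (u := fun i => 2 * M i / (ρ/2)) ((hM.mul_left 2).div_const _) Metric.isOpen_ball
    (convex_ball _ _).isPreconnected
    (fun n z _ => (hf n z).hasFDerivAt) h1 (Metric.mem_ball_self (half_pos hρ)) ?_ hy
  exact Summable.of_norm_bounded hM fun i => hb i x (Metric.mem_ball_self hρ)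

theorem fce_tsum_contDiffAt {ι : Type*} {E : Type} {F : Type*} [NormedAddCommGroup E] [NormedSpace ℂ E]
    [NormedAddCommGroup F] [NormedSpace ℂ F] [CompleteSpace F] {f : ι → E → F} {x : E} (k : ℕ)
    {ρ : ℝ} {M : ι → ℝ} (hρ : 0 < ρ) (hM : Summable M) (hf : ∀ i, ContDiff ℂ ⊤ (f i))
    (hb : ∀ i, ∀ y ∈ Metric.ball x ρ, ‖f i y‖ ≤ M i) :
    ContDiffAt ℂ k (fun y => ∑' i, f i y) x := by
  induction k generalizing F ρ M with
  | zero =>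
    rw [Nat.cast_zero, contDiffAt_zero]
    have := (fce_tsum_hasFDerivAt hρ hM (fun i => (hf i).differentiable (by simp)) hb).2
    refine ⟨Metric.ball x (ρ/2), Metric.ball_mem_nhds _ (half_pos hρ), fun y hy => ?_⟩
    exact (this y hy).continuousAt.continuousWithinAt
  | succ k ih =>
    have h := fce_tsum_hasFDerivAt hρ hM (fun i => (hf i).differentiable (by simp)) hb
    push_cast
    rw [contDiffAt_succ_iff_hasFDerivAt]
    refine ⟨fun y => ∑' i, fderiv ℂ (f i) y, ⟨Metric.ball x (ρ/2),
      Metric.ball_mem_nhds _ (half_pos hρ), h.2⟩, ?_⟩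
    refine ih (half_pos hρ) ((hM.mul_left 2).div_const (ρ/2)) (fun i => ?_) h.1
    exact (hf i).fderiv_right (by simp)

end tsumC

section ev

variable {σ : Type} [Fintype σ] {R : Type*} [NormedRing R] [NormedAlgebra ℂ R] [CompleteSpace R]
variable {W : FWt σ}

/-- monomials -/
def fmono (z : σ → ℂ) (n : σ →₀ ℕ) : ℂ := ∏ i, z i ^ n i

theorem fmono_add (z : σ → ℂ) (m n : σ →₀ ℕ) : fmono z (m + n) = fmono z m * fmono z n := by
  simp [fmono, pow_add, Finset.prod_mul_distrib]

theorem fmono_zero (z : σ → ℂ) : fmono z 0 = 1 := by simp [fmono]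

theorem fmono_single [DecidableEq σ] (z : σ → ℂ) (i : σ) : fmono z (Finsupp.single i 1) = z i := by
  rw [fmono, Finset.prod_eq_single i]
  · simp
  · intro j _ hj
    simp [Finsupp.single_apply, hj.symm]
  · simp

theorem fmono_contDiff (n : σ →₀ ℕ) : ContDiff ℂ ⊤ (fun z : σ → ℂ => fmono z n) := by
  unfold fmono
  fun_prop

theorem fmono_fderiv (n : σ →₀ ℕ) (z c : σ → ℂ) :
    fderiv ℂ (fun z : σ → ℂ => fmono z n) z (fun i => c i * z i) =
      (∑ i, c i * n i) * fmono z n := by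
  classical
  have h1 : HasDerivAt (fun s : ℂ => fmono (fun i => z i + s * (c i * z i)) n)
      (fderiv ℂ (fun z : σ → ℂ => fmono z n) z (fun i => c i * z i)) 0 := by
    have hd : HasFDerivAt (fun z : σ → ℂ => fmono z n)
      (fderiv ℂ (fun z : σ → ℂ => fmono z n) z) ((fun s : ℂ => fun i => z i + s * (c i * z i)) 0) := by
      simp only [zero_mul, add_zero]
      exact ((fmono_contDiff n).differentiable (by simp) z).hasFDerivAt
    have hg : HasDerivAt (fun s : ℂ => fun i => z i + s * (c i * z i)) (fun i => c i * z i) 0 := by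
      rw [hasDerivAt_pi]
      intro i
      simpa using! ((hasDerivAt_id (0:ℂ)).mul_const (c i * z i)).const_add (z i)
    exact HasFDerivAt.comp_hasDerivAt (l := fun z : σ → ℂ => fmono z n) (0 : ℂ) hd hg
  have h2 : HasDerivAt (fun s : ℂ => fmono (fun i => z i + s * (c i * z i)) n)
      ((∑ i, c i * n i) * fmono z n) 0 := by
    have e : (fun s : ℂ => fmono (fun i => z i + s * (c i * z i)) n) =
        fun s => (∏ i, (1 + s * c i) ^ n i) * fmono z n := by
      funext s
      simp only [fmono, ← Finset.prod_mul_distrib, ← mul_pow]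
      refine Finset.prod_congr rfl fun i _ => ?_
      ring
    rw [e]
    refine HasDerivAt.mul_const ?_ _
    have : ∀ i ∈ Finset.univ, HasDerivAt (fun s : ℂ => (1 + s * c i) ^ n i) (c i * n i) 0 := by
      intro i _
      have := (((hasDerivAt_id (0:ℂ)).mul_const (c i)).const_add 1).pow (n i)
      simpa [mul_comm] using! this
    have h3 := HasDerivAt.fun_finsetProd this
    simpa using h3
  exact h1.unique h2

/-- admissible points -/
def FWt.Adm (W : FWt σ) (z : σ → ℂ) : Prop := ∀ n, ‖fmono z n‖ ≤ W.w n

/-- evaluation -/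
noncomputable def FWA.ev (x : FWA W R) (z : σ → ℂ) : R := ∑' n, fmono z n • x.co n

theorem FWA.ev_bd (x : FWA W R) {z : σ → ℂ} (hz : W.Adm z) (n) :
    ‖fmono z n • x.co n‖ ≤ ‖x.co n‖ * W.w n := by
  rw [norm_smul, mul_comm]
  exact mul_le_mul_of_nonneg_left (hz n) (norm_nonneg _)

theorem FWA.ev_sm (x : FWA W R) {z : σ → ℂ} (hz : W.Adm z) :
    Summable fun n => ‖fmono z n • x.co n‖ :=
  Summable.of_nonneg_of_le (fun _ => norm_nonneg _) (x.ev_bd hz) x.sm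

theorem FWA.ev_norm (x : FWA W R) {z : σ → ℂ} (hz : W.Adm z) : ‖x.ev z‖ ≤ ‖x‖ :=
  (norm_tsum_le_tsum_norm (x.ev_sm hz)).trans ((x.ev_sm hz).tsum_le_tsum (x.ev_bd hz) x.sm)

theorem FWA.ev_C (a : R) (z : σ → ℂ) : (FWA.C a : FWA W R).ev z = a := by
  classical
  unfold FWA.ev
  rw [tsum_eq_single 0]
  · simp [FWA.co_C, fmono_zero]
  · intro n hn; simp [FWA.co_C, hn]

theorem FWA.ev_mul {z : σ → ℂ} (hz : W.Adm z) (x y : FWA W R) :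
    (x * y).ev z = x.ev z * y.ev z := by
  classical
  have hx := x.ev_sm hz
  have hy := y.ev_sm hz
  have h := Summable.tsum_mul_tsum_eq_tsum_sum_antidiagonal (A := σ →₀ ℕ)
    (f := fun n => fmono z n • x.co n) (g := fun n => fmono z n • y.co n) hx.of_norm hy.of_norm
    (summable_mul_of_summable_norm (f := fun n => fmono z n • x.co n)
      (g := fun n => fmono z n • y.co n) hx hy)
  refine Eq.trans (tsum_congr fun n => ?_) h.symm
  rw [FWA.co_mul, Finset.smul_sum]
  refine Finset.sum_congr rfl fun p hp => ?_
  rw [Finset.HasAntidiagonal.mem_antidiagonal] at hp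
  rw [← hp, fmono_add, smul_mul_smul_comm]

/-- evaluation as an algebra hom -/
noncomputable def FWA.evHom {z : σ → ℂ} (hz : W.Adm z) : FWA W R →+* R where
  toFun x := x.ev z
  map_one' := by
    have := FWA.ev_C (W := W) (1 : R) z
    rwa [map_one] at this
  map_zero' := by simp [FWA.ev]
  map_add' x y := by
    simp only [FWA.ev, FWA.co_add, smul_add]
    exact (x.ev_sm hz).of_norm.tsum_add (y.ev_sm hz).of_norm
  map_mul' x y := FWA.ev_mul hz x y

/-- evaluation as a continuous linear map -/
noncomputable def FWA.evL {z : σ → ℂ} (hz : W.Adm z) : FWA W R →L[ℂ] R :=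
  LinearMap.mkContinuous
    { toFun := fun x => x.ev z
      map_add' := (FWA.evHom hz).map_add
      map_smul' := fun c x => by
        simp only [FWA.ev, FWA.co_smul, smul_comm _ c, RingHom.id_apply]
        exact tsum_const_smul'' c } 1 (fun x => by rw [one_mul]; exact x.ev_norm hz)

/-- coordinates -/
noncomputable def FWA.X (i : σ) : FWA W R := ⟨MvPowerSeries.X i, by
  classical
  refine summable_of_ne_finset_zero (s := {Finsupp.single i 1}) fun n hn => ?_
  rw [Finset.mem_singleton] at hn
  simp [MvPowerSeries.coeff_X, hn]⟩

theorem FWA.co_X [DecidableEq σ] (i : σ) (n) :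
    (FWA.X i : FWA W R).co n = if n = Finsupp.single i 1 then 1 else 0 :=
  MvPowerSeries.coeff_X n i

theorem FWA.ev_X (i : σ) (z : σ → ℂ) : (FWA.X i : FWA W R).ev z = algebraMap ℂ R (z i) := by
  classical
  unfold FWA.ev
  rw [tsum_eq_single (Finsupp.single i 1)]
  · simp [FWA.co_X, fmono_single, Algebra.algebraMap_eq_smul_one]
  · intro n hn; simp [FWA.co_X, hn]

theorem FWA.norm_X (i : σ) : ‖(FWA.X i : FWA W R)‖ = ‖(1 : R)‖ * W.w (Finsupp.single i 1) := by
  classical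
  rw [FWA.norm_def, tsum_eq_single (Finsupp.single i 1)]
  · simp [FWA.co_X]
  · intro n hn; simp [FWA.co_X, hn]

theorem FWA.ev_contDiffAt (x : FWA W R) {z : σ → ℂ} {ρ : ℝ} (hρ : 0 < ρ)
    (h : ∀ y ∈ Metric.ball z ρ, W.Adm y) (k : ℕ) : ContDiffAt ℂ k x.ev z :=
  fce_tsum_contDiffAt k hρ x.sm (fun n => (fmono_contDiff n).smul contDiff_const)
    (fun n y hy => x.ev_bd (h y hy) n)

theorem FWA.ev_fderiv (x : FWA W R) {z : σ → ℂ} {ρ : ℝ} (hρ : 0 < ρ)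
    (h : ∀ y ∈ Metric.ball z ρ, W.Adm y) (c : σ → ℂ) :
    fderiv ℂ x.ev z (fun i => c i * z i) = ∑' n, ((∑ i, c i * n i) * fmono z n) • x.co n := by
  have hd : ∀ n : σ →₀ ℕ, Differentiable ℂ (fun z => fmono z n • x.co n) := fun n =>
    ((fmono_contDiff n).differentiable (by simp)).smul_const _
  obtain ⟨h1, h2⟩ := fce_tsum_hasFDerivAt hρ x.sm hd (fun n y hy => x.ev_bd (h y hy) n)
  have h3 := h2 z (Metric.mem_ball_self (half_pos hρ))
  have h4 : fderiv ℂ x.ev z = _ := h3.fderiv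
  have h5 : Summable fun n => fderiv ℂ (fun z => fmono z n • x.co n) z :=
    Summable.of_norm_bounded ((x.sm.mul_left 2).div_const (ρ/2))
      (fun n => h1 n z (Metric.mem_ball_self (half_pos hρ)))
  have h6 := (ContinuousLinearMap.apply ℂ R (fun i => c i * z i)).map_tsum h5
  simp only [ContinuousLinearMap.apply_apply] at h6
  rw [h4, h6]
  refine tsum_congr fun n => ?_
  rw [fderiv_smul_const ((fmono_contDiff n).differentiable (by simp) z)]
  simp [fmono_fderiv]

end ev




section weight

/-- scalar weight -/
noncomputable def fw (m k : ℕ) : ℝ := ⨆ x : Set.Icc (0:ℝ) 1, (x:ℝ) ^ k * Real.exp (-(m * x))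

theorem fw_bdd (m k : ℕ) :
    BddAbove (Set.range fun x : Set.Icc (0:ℝ) 1 => (x:ℝ) ^ k * Real.exp (-(m * x))) := by
  refine ⟨1, ?_⟩
  rintro _ ⟨⟨x, h0, h1⟩, rfl⟩
  have h2 : x ^ k ≤ 1 := pow_le_one₀ h0 h1
  have h3 : Real.exp (-(m * x)) ≤ 1 := by
    rw [Real.exp_le_one_iff]
    have : 0 ≤ (m:ℝ) * x := by positivity
    linarith
  exact mul_le_one₀ h2 (Real.exp_pos _).le h3

theorem fw_le (m k : ℕ) {x : ℝ} (h0 : 0 ≤ x) (h1 : x ≤ 1) :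
    x ^ k * Real.exp (-(m * x)) ≤ fw m k :=
  le_ciSup (fw_bdd m k) (⟨x, h0, h1⟩ : Set.Icc (0:ℝ) 1)

theorem fw_exp (m k : ℕ) : Real.exp (-m) ≤ fw m k := by
  simpa using fw_le m k (x := 1) zero_le_one le_rfl

instance : Nonempty (Set.Icc (0:ℝ) 1) := ⟨⟨0, by simp⟩⟩

theorem fw_le_one (m k : ℕ) : fw m k ≤ 1 := by
  refine ciSup_le ?_
  rintro ⟨x, h0, h1⟩
  have h2 : x ^ k ≤ 1 := pow_le_one₀ h0 h1
  have h3 : Real.exp (-(m * x)) ≤ 1 := by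
    rw [Real.exp_le_one_iff]
    have : 0 ≤ (m:ℝ) * x := by positivity
    linarith
  exact mul_le_one₀ h2 (Real.exp_pos _).le h3

theorem fw_pos (m k : ℕ) : 0 < fw m k := (Real.exp_pos _).trans_le (fw_exp m k)

theorem fw_mul (m k m' k' : ℕ) : fw (m + m') (k + k') ≤ fw m k * fw m' k' := by
  refine ciSup_le ?_
  rintro ⟨x, h0, h1⟩
  have := mul_le_mul (fw_le m k h0 h1) (fw_le m' k' h0 h1) (by positivity) (fw_pos m k).le
  refine le_trans (le_of_eq ?_) this
  simp only
  push_cast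
  rw [show -((m + m' : ℝ) * x) = -(m * x) + -(m' * x) by ring, Real.exp_add, pow_add]
  ring

theorem fw_key (m k : ℕ) : m * fw m (k + 1) ≤ (k + 1) * fw m k := by
  rw [fw, Real.mul_iSup_of_nonneg (by positivity)]
  refine ciSup_le ?_
  rintro ⟨x, h0, h1⟩
  have hd : ∀ s : ℝ, HasDerivAt (fun s : ℝ => (k + 1) * fw m k * Real.exp (m * s) - m * s ^ (k+1))
      ((k + 1) * fw m k * (Real.exp (m * s) * m) - m * ((k+1) * s ^ k)) s := by
    intro s
    have h1 := (((hasDerivAt_id s).const_mul (m:ℝ)).exp).const_mul ((k + 1) * fw m k)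
    have h2 := (hasDerivAt_pow (k+1) s).const_mul (m:ℝ)
    simpa using! h1.sub h2
  have hm : MonotoneOn (fun s : ℝ => (k + 1) * fw m k * Real.exp (m * s) - m * s ^ (k+1))
      (Set.Icc 0 1) := by
    refine monotoneOn_of_deriv_nonneg (convex_Icc _ _) (fun s _ => (hd s).continuousAt.continuousWithinAt)
      (fun s _ => (hd s).differentiableAt.differentiableWithinAt) ?_
    intro s hs
    rw [interior_Icc] at hs
    rw [(hd s).deriv]
    have h3 := fw_le m k hs.1.le hs.2.le
    rw [Real.exp_neg, ← div_eq_mul_inv, div_le_iff₀ (Real.exp_pos _)] at h3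
    have : 0 ≤ ((k:ℝ)+1) * m * (fw m k * Real.exp (m * s) - s ^ k) :=
      mul_nonneg (by positivity) (by linarith)
    linarith
  have h4 := hm (a := 0) (by simp) ⟨h0, h1⟩ h0
  simp only [mul_zero, Real.exp_zero, mul_one] at h4
  have h5 : 0 ≤ (k + 1) * fw m k := mul_nonneg (by positivity) (fw_pos _ _).le
  have h6 : (0:ℝ) ^ (k+1) = 0 := by simp
  rw [h6] at h4
  simp only
  rw [Real.exp_neg, ← mul_assoc, ← div_eq_mul_inv, div_le_iff₀ (Real.exp_pos _)]
  linarith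

end weight

section ops

variable {r l : ℕ}

/-- degree in q -/
def fM (n : Fin r ⊕ Fin l →₀ ℕ) : ℕ := ∑ a, n (Sum.inl a)
/-- degree in t -/
def fK (n : Fin r ⊕ Fin l →₀ ℕ) : ℕ := ∑ j, n (Sum.inr j)

/-- the weight -/
noncomputable def fWt (r l : ℕ) : FWt (Fin r ⊕ Fin l) where
  w n := fw (fM n) (fK n)
  pos n := fw_pos _ _
  zero := by
    simp [fw, fM, fK]
  mul m n := by
    have := fw_mul (fM m) (fK m) (fM n) (fK n)
    simpa [fM, fK, Finset.sum_add_distrib] using this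

theorem fWt_adm {z : Fin r ⊕ Fin l → ℂ} (h1 : ∀ a, ‖z (Sum.inl a)‖ ≤ Real.exp (-1))
    (h2 : ∀ j, ‖z (Sum.inr j)‖ ≤ 1) : (fWt r l).Adm z := by
  intro n
  refine le_trans ?_ (fw_exp (fM n) (fK n))
  rw [fmono, norm_prod, Fintype.prod_sum_type]
  have e1 : ∏ a, ‖z (Sum.inl a) ^ n (Sum.inl a)‖ ≤ Real.exp (-(fM n)) := by
    calc _ ≤ ∏ a : Fin r, Real.exp (-1) ^ n (Sum.inl a) := by
          refine Finset.prod_le_prod (fun _ _ => norm_nonneg _) fun a _ => ?_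
          rw [norm_pow]
          exact pow_le_pow_left₀ (norm_nonneg _) (h1 a) _
      _ = _ := by
          rw [Finset.prod_pow_eq_pow_sum, ← Real.exp_nat_mul]
          simp [fM]
  have e2 : ∏ j, ‖z (Sum.inr j) ^ n (Sum.inr j)‖ ≤ 1 := by
    refine Finset.prod_le_one (fun _ _ => norm_nonneg _) fun j _ => ?_
    rw [norm_pow]
    exact pow_le_one₀ (norm_nonneg _) (h2 j)
  calc _ ≤ Real.exp (-(fM n)) * 1 :=
        mul_le_mul e1 e2 (Finset.prod_nonneg fun _ _ => norm_nonneg _) (Real.exp_pos _).le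
    _ = _ := mul_one _

variable {R : Type*} [NormedRing R] [NormedAlgebra ℂ R] [CompleteSpace R]

/-- coefficients of the integrated operator -/
noncomputable def fNco (a : Fin r) (j : Fin l) (F : FWA (fWt r l) R) (n : Fin r ⊕ Fin l →₀ ℕ) : R :=
  if n (Sum.inr j) = 0 then 0 else
    ((n (Sum.inl a) : ℂ) / (fK n : ℂ)) • F.co (n - Finsupp.single (Sum.inr j) 1)

theorem fNco_add (a : Fin r) (j : Fin l) (F : FWA (fWt r l) R) (m : Fin r ⊕ Fin l →₀ ℕ) :
    fNco a j F (m + Finsupp.single (Sum.inr j) 1) =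
      ((m (Sum.inl a) : ℂ) / (fK m + 1 : ℂ)) • F.co m := by
  simp [fNco, fK, Finset.sum_add_distrib, Finsupp.single_apply]

theorem fN_inj (j : Fin l) : Function.Injective
    (fun m : Fin r ⊕ Fin l →₀ ℕ => m + Finsupp.single (Sum.inr j) 1) :=
  add_left_injective _

theorem fNco_supp (a : Fin r) (j : Fin l) (F : FWA (fWt r l) R) (n : Fin r ⊕ Fin l →₀ ℕ)
    (hn : n ∉ Set.range (fun m : Fin r ⊕ Fin l →₀ ℕ => m + Finsupp.single (Sum.inr j) 1)) :
    fNco a j F n = 0 := by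
  by_contra h
  have h0 : n (Sum.inr j) ≠ 0 := by
    intro h0
    exact h (by simp [fNco, h0])
  refine hn ⟨n - Finsupp.single (Sum.inr j) 1, ?_⟩
  have : Finsupp.single (Sum.inr j) 1 ≤ n := by
    rw [Finsupp.single_le_iff]; omega
  exact tsub_add_cancel_of_le this

theorem fN_term (a : Fin r) (j : Fin l) (F : FWA (fWt r l) R) (m : Fin r ⊕ Fin l →₀ ℕ) :
    ‖fNco a j F (m + Finsupp.single (Sum.inr j) 1)‖ * (fWt r l).w (m + Finsupp.single (Sum.inr j) 1)
      ≤ ‖F.co m‖ * (fWt r l).w m := by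
  rw [fNco_add, norm_smul]
  have h1 : (fWt r l).w (m + Finsupp.single (Sum.inr j) 1) = fw (fM m) (fK m + 1) := by
    simp [fWt, fM, fK, Finset.sum_add_distrib, Finsupp.single_apply]
  have h2 : (fWt r l).w m = fw (fM m) (fK m) := rfl
  rw [h1, h2]
  have h3 := fw_key (fM m) (fK m)
  have h4 : ‖(m (Sum.inl a) : ℂ) / (fK m + 1 : ℂ)‖ = (m (Sum.inl a) : ℝ) / (fK m + 1 : ℝ) := by
    rw [norm_div]
    have : ((fK m : ℂ) + 1) = ((fK m + 1 : ℕ) : ℂ) := by push_cast; rfl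
    rw [this, Complex.norm_natCast, Complex.norm_natCast]
    push_cast; rfl
  have h5 : (m (Sum.inl a) : ℝ) ≤ fM m := by
    exact_mod_cast Finset.single_le_sum (f := fun a => m (Sum.inl a)) (fun _ _ => Nat.zero_le _)
      (Finset.mem_univ a)
  rw [h4]
  have h6 : (m (Sum.inl a) : ℝ) / (fK m + 1 : ℝ) * fw (fM m) (fK m + 1) ≤ fw (fM m) (fK m) := by
    rw [div_mul_eq_mul_div, div_le_iff₀ (by positivity)]
    calc _ ≤ (fM m : ℝ) * fw (fM m) (fK m + 1) :=
          mul_le_mul_of_nonneg_right h5 (fw_pos _ _).le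
      _ ≤ _ := h3
      _ = _ := mul_comm _ _
  calc _ = ‖F.co m‖ * ((m (Sum.inl a) : ℝ) / (fK m + 1 : ℝ) * fw (fM m) (fK m + 1)) := by ring
    _ ≤ _ := mul_le_mul_of_nonneg_left h6 (norm_nonneg _)

theorem fN_summable (a : Fin r) (j : Fin l) (F : FWA (fWt r l) R) :
    Summable fun n => ‖fNco a j F n‖ * (fWt r l).w n := by
  rw [← (fN_inj j).summable_iff]
  · exact Summable.of_nonneg_of_le
      (fun n => mul_nonneg (norm_nonneg _) ((fWt r l).pos _).le) (fN_term a j F) F.sm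
  · intro n hn
    simp [fNco_supp a j F n hn]

/-- the integrated operator -/
noncomputable def fN (a : Fin r) (j : Fin l) : FWA (fWt r l) R →L[ℂ] FWA (fWt r l) R :=
  LinearMap.mkContinuous
    { toFun := fun F => FWA.mk' (fNco a j F) (fN_summable a j F)
      map_add' := fun F G => by
        apply FWA.ext'; intro n
        simp only [FWA.co_mk', FWA.co_add, fNco]
        split_ifs <;> simp
      map_smul' := fun c F => by
        apply FWA.ext'; intro n
        simp only [FWA.co_mk', FWA.co_smul, fNco, RingHom.id_apply]
        split_ifs
        · simp
        · rw [smul_comm] } 1 (fun F => by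
      rw [one_mul, FWA.norm_def, FWA.norm_def]
      simp only [LinearMap.coe_mk, AddHom.coe_mk, FWA.co_mk']
      rw [← (fN_inj j).tsum_eq]
      · refine Summable.tsum_le_tsum (fN_term a j F) ?_ F.sm
        exact (fN_summable a j F).comp_injective (fN_inj j)
      · intro n hn
        by_contra h
        exact hn (by simp [fNco_supp a j F n h]))

theorem fN_co (a : Fin r) (j : Fin l) (F : FWA (fWt r l) R) (n) : (fN a j F).co n = fNco a j F n := rfl

theorem fN_euler (a : Fin r) (j : Fin l) (F : FWA (fWt r l) R) {z : Fin r ⊕ Fin l → ℂ} {ρ : ℝ}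
    (hρ : 0 < ρ) (h : ∀ y ∈ Metric.ball z ρ, (fWt r l).Adm y) :
    fderiv ℂ (fN a j F).ev z (Sum.elim 0 (fun k => z (Sum.inr k))) =
      z (Sum.inr j) • fderiv ℂ F.ev z (Pi.single (Sum.inl a) (z (Sum.inl a))) := by
  have e1 : (Sum.elim 0 (fun k => z (Sum.inr k)) : Fin r ⊕ Fin l → ℂ) =
      fun i => (Sum.elim 0 1 : Fin r ⊕ Fin l → ℂ) i * z i := by
    funext i; cases i <;> simp
  have e2 : (Pi.single (Sum.inl a) (z (Sum.inl a)) : Fin r ⊕ Fin l → ℂ) =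
      fun i => (Pi.single (Sum.inl a) 1 : Fin r ⊕ Fin l → ℂ) i * z i := by
    funext i
    by_cases hi : i = Sum.inl a
    · subst hi; simp
    · simp [hi]
  rw [e1, e2, FWA.ev_fderiv _ hρ h, FWA.ev_fderiv _ hρ h, ← tsum_const_smul'']
  rw [← (fN_inj j).tsum_eq]
  · refine tsum_congr fun m => ?_
    rw [fN_co, fNco_add, fmono_add, fmono_single]
    have h1 : (∑ i, (Sum.elim 0 1 : Fin r ⊕ Fin l → ℂ) i *
        ((m + Finsupp.single (Sum.inr j) 1 : Fin r ⊕ Fin l →₀ ℕ) i : ℂ)) = fK m + 1 := by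
      simp [fK, Finset.sum_add_distrib, Finsupp.single_apply]
    have h2 : (∑ i, (Pi.single (Sum.inl a) 1 : Fin r ⊕ Fin l → ℂ) i * (m i : ℂ)) = m (Sum.inl a) := by
      rw [Finset.sum_eq_single (Sum.inl a)]
      · simp
      · intro b _ hb; simp [hb]
      · simp
    have h3 : (fK m + 1 : ℂ) ≠ 0 := Nat.cast_add_one_ne_zero (fK m)
    rw [h1, h2, smul_smul, smul_smul]
    congr 1
    field_simp
  · intro n hn
    by_contra h
    exact hn (by simp [fN_co, fNco_supp a j F n h])

theorem fN_init (a : Fin r) (j : Fin l) (F : FWA (fWt r l) R) {z : Fin r ⊕ Fin l → ℂ}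
    (hz : ∀ j, z (Sum.inr j) = 0) : (fN a j F).ev z = 0 := by
  unfold FWA.ev
  convert tsum_zero with n
  rw [fN_co, fNco]
  split_ifs with h
  · simp
  · have : fmono z n = 0 := by
      rw [fmono]
      refine Finset.prod_eq_zero (Finset.mem_univ (Sum.inr j)) ?_
      rw [hz]; exact zero_pow h
    simp [this]

/-- total degree -/
def fD (n : Fin r ⊕ Fin l →₀ ℕ) : ℕ := ∑ i, n i

theorem fmono_scale (ρ : ℂ) (z : Fin r ⊕ Fin l → ℂ) (n) : fmono (ρ • z) n = ρ ^ fD n * fmono z n := by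
  simp [fmono, fD, mul_pow, Finset.prod_mul_distrib, Finset.prod_pow_eq_pow_sum]

theorem fscale (F : FWA (fWt r l) R) {ρ : ℝ} (h0 : 0 ≤ ρ) (h1 : ρ ≤ 1) :
    ∃ G : FWA (fWt r l) R, (∀ z, G.ev z = F.ev ((ρ:ℂ) • z)) ∧
      ‖G - FWA.C (F.ev 0)‖ ≤ ρ * ‖F‖ := by
  classical
  have hb : ∀ n, ‖((ρ:ℂ) ^ fD n) • F.co n‖ ≤ ‖F.co n‖ := by
    intro n
    rw [norm_smul, norm_pow, Complex.norm_real, Real.norm_eq_abs, abs_of_nonneg h0]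
    exact mul_le_of_le_one_left (norm_nonneg _) (pow_le_one₀ h0 h1)
  have hs : Summable fun n => ‖((ρ:ℂ) ^ fD n) • F.co n‖ * (fWt r l).w n :=
    Summable.of_nonneg_of_le (fun n => mul_nonneg (norm_nonneg _) ((fWt r l).pos _).le)
      (fun n => mul_le_mul_of_nonneg_right (hb n) ((fWt r l).pos _).le) F.sm
  have hF0 : F.ev 0 = F.co 0 := by
    unfold FWA.ev
    rw [tsum_eq_single 0]
    · simp [fmono_zero]
    · intro n hn
      obtain ⟨i, hi⟩ : ∃ i, n i ≠ 0 := by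
        by_contra h; push Not at h; exact hn (Finsupp.ext h)
      have : fmono (0 : Fin r ⊕ Fin l → ℂ) n = 0 :=
        Finset.prod_eq_zero (Finset.mem_univ i) (zero_pow hi)
      simp [this]
  refine ⟨FWA.mk' _ hs, fun z => ?_, ?_⟩
  · unfold FWA.ev
    refine tsum_congr fun n => ?_
    rw [FWA.co_mk', fmono_scale, smul_smul, mul_comm]
  · rw [FWA.norm_def, FWA.norm_def, ← tsum_mul_left]
    refine Summable.tsum_le_tsum (fun n => ?_) (FWA.sm _) (F.sm.mul_left _)
    rw [← mul_assoc]
    refine mul_le_mul_of_nonneg_right ?_ ((fWt r l).pos _).le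
    rw [FWA.co_sub, FWA.co_C, FWA.co_mk', hF0]
    by_cases hn : n = 0
    · subst hn
      simp [fD]; positivity
    · simp only [hn, if_false, sub_zero]
      rw [norm_smul, norm_pow, Complex.norm_real, Real.norm_eq_abs, abs_of_nonneg h0]
      refine mul_le_mul_of_nonneg_right ?_ (norm_nonneg _)
      refine pow_le_of_le_one h0 h1 ?_
      intro h
      apply hn
      ext i
      exact (Finset.sum_eq_zero_iff.1 h) i (Finset.mem_univ i)

end ops




section initpart

variable {r l : ℕ} {R : Type*} [NormedRing R] [NormedAlgebra ℂ R] [CompleteSpace R]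

theorem fX_unit (h1 : ‖(1:R)‖ ≤ 1) (a : Fin r) {c : ℂ} (hc : ‖c‖ = 2) :
    IsUnit (algebraMap ℂ (FWA (fWt r l) R) c - FWA.X (Sum.inl a)) := by
  have hc0 : c ≠ 0 := by rintro rfl; simp at hc
  have hX : ‖(FWA.X (Sum.inl a) : FWA (fWt r l) R)‖ ≤ 1 := by
    rw [FWA.norm_X]
    exact mul_le_one₀ h1 ((fWt r l).pos _).le (fw_le_one _ _)
  have ht : ‖c⁻¹ • (FWA.X (Sum.inl a) : FWA (fWt r l) R)‖ < 1 := by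
    rw [norm_smul, norm_inv, hc]; linarith
  have h2 : IsUnit (1 - c⁻¹ • (FWA.X (Sum.inl a) : FWA (fWt r l) R)) :=
    (Units.oneSub _ ht).isUnit
  have h3 : IsUnit (algebraMap ℂ (FWA (fWt r l) R) c) := (IsUnit.mk0 c hc0).map _
  have h4 := h3.mul h2
  convert h4 using 1
  rw [mul_sub, mul_one, ← Algebra.smul_def, smul_smul, mul_inv_cancel₀ hc0, one_smul]

set_option maxHeartbeats 1000000 in
theorem finit_aux (h1 : ‖(1:R)‖ ≤ 1) {g : (Fin r → ℂ) → R} {O : Set (Fin r → ℂ)} (hO : IsOpen O)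
    (hO2 : Metric.closedBall 0 2 ⊆ O) (hg : DifferentiableOn ℂ g O) (s : Finset (Fin r)) :
    ∃ f : (Fin r → ℝ) → FWA (fWt r l) R, Continuous f ∧
      ∀ θ z, (fWt r l).Adm z → (∀ a, ‖z (Sum.inl a)‖ ≤ 1) →
        (f θ).ev z = g (fun a => if a ∈ s then z (Sum.inl a) else circleMap 0 2 (θ a)) := by
  have hmem : ∀ y : Fin r → ℂ, (∀ a, ‖y a‖ ≤ 2) → y ∈ O := fun y hy => hO2 (by
    rw [mem_closedBall_zero_iff, pi_norm_le_iff_of_nonneg (by norm_num)]; exact hy)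
  induction s using Finset.induction_on with
  | empty =>
    refine ⟨fun θ => FWA.C (g (fun a => circleMap 0 2 (θ a))), ?_, ?_⟩
    · refine FWA.continuous_C.comp ?_
      refine hg.continuousOn.comp_continuous ?_ ?_
      · refine continuous_pi fun a => (continuous_circleMap 0 2).comp (continuous_apply a)
      · intro θ
        refine hmem _ fun a => ?_
        simp
    · intro θ z _ _
      simp [FWA.ev_C]
  | insert a s has ih =>
    obtain ⟨f, hf, hfe⟩ := ih
    have hcirc : ∀ φ : ℝ, ‖circleMap 0 2 φ‖ = 2 := fun φ => by simp
    obtain ⟨K, hKd⟩ : ∃ K : (Fin r → ℝ) → ℝ → FWA (fWt r l) R, ∀ θ φ, K θ φ =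
      (circleMap 0 2 φ * Complex.I) • (Ring.inverse (algebraMap ℂ (FWA (fWt r l) R) (circleMap 0 2 φ)
        - FWA.X (Sum.inl a)) * f (Function.update θ a φ)) := ⟨_, fun _ _ => rfl⟩
    have hK : Continuous K.uncurry := by
      have hinv : Continuous fun φ : ℝ => Ring.inverse (algebraMap ℂ (FWA (fWt r l) R) (circleMap 0 2 φ)
        - FWA.X (Sum.inl a)) := by
        rw [continuous_iff_continuousAt]
        intro φ
        obtain ⟨u, hu⟩ := fX_unit (l := l) h1 a (hcirc φ)
        refine ContinuousAt.comp (g := Ring.inverse) ?_ ?_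
        · rw [← hu]; exact NormedRing.inverse_continuousAt u
        · refine ContinuousAt.sub ?_ continuousAt_const
          exact ((algebraMapCLM ℂ (FWA (fWt r l) R)).continuous.comp
            (continuous_circleMap 0 2)).continuousAt
      have c1 : Continuous fun p : (Fin r → ℝ) × ℝ => circleMap 0 2 p.2 * Complex.I :=
        (((continuous_circleMap 0 2).comp continuous_snd).mul continuous_const)
      have c2 : Continuous fun p : (Fin r → ℝ) × ℝ => f (Function.update p.1 a p.2) :=
        hf.comp (continuous_fst.update a continuous_snd)
      have c3 : Continuous fun p : (Fin r → ℝ) × ℝ => Ring.inverse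
        (algebraMap ℂ (FWA (fWt r l) R) (circleMap 0 2 p.2) - FWA.X (Sum.inl a)) :=
        hinv.comp continuous_snd
      have c5 := c1.smul (c3.mul c2)
      refine c5.congr fun p => ?_
      exact (hKd p.1 p.2).symm
    refine ⟨fun θ => (2 * Real.pi * Complex.I : ℂ)⁻¹ • ∫ φ in (0:ℝ)..2 * Real.pi, K θ φ, ?_, ?_⟩
    · have c4 : Continuous fun θ => ∫ φ in (0:ℝ)..2 * Real.pi, K θ φ :=
        intervalIntegral.continuous_parametric_intervalIntegral_of_continuous' hK _ _
      exact (continuous_const (y := (2 * Real.pi * Complex.I : ℂ)⁻¹)).smul c4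
    · intro θ z hz hz1
      change FWA.evL hz _ = _
      have hKc : Continuous (K θ) := by
        have h9 : Continuous fun φ : ℝ => (θ, φ) := Continuous.prodMk_right θ
        exact Continuous.comp (g := K.uncurry) hK h9
      rw [map_smul, ← ContinuousLinearMap.intervalIntegral_comp_comm _ (hKc.intervalIntegrable _ _)]
      let G : ℂ → R := fun w => g (fun b => if b = a then w else
        if b ∈ s then z (Sum.inl b) else circleMap 0 2 (θ b))
      have hev : ∀ φ, FWA.evL hz (K θ φ) =
          deriv (circleMap 0 2) φ • ((circleMap 0 2 φ - z (Sum.inl a))⁻¹ • G (circleMap 0 2 φ)) := by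
        intro φ
        have hu := fX_unit (l := l) (R := R) h1 a (hcirc φ)
        have h3 := Ring.mul_inverse_cancel _ hu
        have h4 := congrArg (FWA.evHom hz) h3
        rw [map_mul, map_one, map_sub] at h4
        have h5 : (FWA.evHom hz) (algebraMap ℂ (FWA (fWt r l) R) (circleMap 0 2 φ)) =
            algebraMap ℂ R (circleMap 0 2 φ) := by
          rw [Algebra.algebraMap_eq_smul_one]
          change FWA.evL hz _ = _
          rw [map_smul, Algebra.algebraMap_eq_smul_one]
          congr 1
          exact map_one (FWA.evHom hz)
        have h6 : (FWA.evHom hz) (FWA.X (Sum.inl a) : FWA (fWt r l) R) =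
            algebraMap ℂ R (z (Sum.inl a)) := FWA.ev_X _ _
        rw [h5, h6, ← map_sub, ← Algebra.smul_def] at h4
        have hne : circleMap 0 2 φ - z (Sum.inl a) ≠ 0 := by
          intro h
          have := hcirc φ
          rw [sub_eq_zero.1 h] at this
          linarith [hz1 a]
        have h7 : (FWA.evHom hz) (Ring.inverse (algebraMap ℂ (FWA (fWt r l) R) (circleMap 0 2 φ)
            - FWA.X (Sum.inl a))) = (circleMap 0 2 φ - z (Sum.inl a))⁻¹ • 1 := by
          rw [← h4, smul_smul, inv_mul_cancel₀ hne, one_smul]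
        rw [deriv_circleMap]
        rw [hKd]
        rw [map_smul]
        congr 1
        change FWA.ev _ z = _
        rw [FWA.ev_mul hz]
        change FWA.evHom hz _ * _ = _
        rw [h7, hfe _ _ hz hz1, smul_mul_assoc, one_mul]
        congr 2
        funext b
        by_cases hb : b = a
        · subst hb; simp [has]
        · simp [hb]
      simp only [hev]
      have hw : z (Sum.inl a) ∈ Metric.ball (0:ℂ) 2 := by
        rw [mem_ball_zero_iff]; linarith [hz1 a]
      have hin : ∀ w : ℂ, ‖w‖ ≤ 2 → (fun b => if b = a then w else
        if b ∈ s then z (Sum.inl b) else circleMap 0 2 (θ b)) ∈ O := by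
        intro w hw
        refine hmem _ fun b => ?_
        split_ifs
        · exact hw
        · linarith [hz1 b]
        · simp
      have hGd : ∀ w : ℂ, ‖w‖ ≤ 2 → DifferentiableAt ℂ G w := by
        intro w hw
        have h8 := (hg _ (hin w hw)).differentiableAt (hO.mem_nhds (hin w hw))
        refine DifferentiableAt.comp (g := g) w h8 ?_
        rw [differentiableAt_pi]
        intro b
        split_ifs <;> fun_prop
      have hC := Complex.two_pi_I_inv_smul_circleIntegral_sub_inv_smul_of_differentiable_on_off_countable
        (f := G) Set.countable_empty hw
        (fun w hw => (hGd w (by simpa using hw)).continuousAt.continuousWithinAt)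
        (fun w hw => hGd w (by have := hw.1; rw [mem_ball_zero_iff] at this; exact this.le))
      rw [circleIntegral] at hC
      rw [hC]
      simp only [G]
      congr 1
      funext b
      by_cases hb : b = a
      · subst hb; simp
      · simp [hb]

theorem finit (h1 : ‖(1:R)‖ ≤ 1) {g : (Fin r → ℂ) → R} {O : Set (Fin r → ℂ)} (hO : IsOpen O)
    (hO2 : Metric.closedBall 0 2 ⊆ O) (hg : DifferentiableOn ℂ g O) :
    ∃ F : FWA (fWt r l) R, ∀ z, (∀ a, ‖z (Sum.inl a)‖ ≤ Real.exp (-1)) →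
      (∀ j, ‖z (Sum.inr j)‖ ≤ 1) → F.ev z = g (fun a => z (Sum.inl a)) := by
  obtain ⟨f, _, hf⟩ := finit_aux (l := l) h1 hO hO2 hg Finset.univ
  refine ⟨f 0, fun z h1 h2 => ?_⟩
  rw [hf 0 z (fWt_adm h1 h2) fun a => (h1 a).trans (by simp)]
  simp

end initpart




section solve

theorem fce_solve {B : Type*} [NormedAddCommGroup B] [NormedSpace ℂ B] [CompleteSpace B]
    {G : B → B} {x0 : B} (hG : ContDiffAt ℂ 1 G x0) {S : Set B} (hS : S ∈ 𝓝 x0) :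
    ∃ δ > 0, ∀ ε : ℂ, ‖ε‖ < δ → ∀ y, ‖y - x0‖ < δ → ∃ u ∈ S, u = y + ε • G u := by
  obtain ⟨G', hG'⟩ : ∃ G', HasStrictFDerivAt G G' x0 := ⟨_, hG.hasStrictFDerivAt (by simp)⟩
  let H : ℂ × B → ℂ × B := fun p => (p.1, p.2 - p.1 • G p.2)
  have h1 : HasStrictFDerivAt (fun p : ℂ × B => p.1) (ContinuousLinearMap.fst ℂ ℂ B) ((0:ℂ), x0) :=
    hasStrictFDerivAt_fst
  have h2 : HasStrictFDerivAt (fun p : ℂ × B => p.2) (ContinuousLinearMap.snd ℂ ℂ B) ((0:ℂ), x0) :=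
    hasStrictFDerivAt_snd
  have h3 : HasStrictFDerivAt (fun p : ℂ × B => G p.2) (G'.comp (ContinuousLinearMap.snd ℂ ℂ B))
      ((0:ℂ), x0) := HasStrictFDerivAt.comp ((0:ℂ), x0) (g := G) hG' h2
  have hH := h1.prodMk (h2.sub (h1.smul h3))
  have hsurj := hH.map_nhds_eq_of_surj (by
    rw [LinearMap.range_eq_top]
    intro y
    refine ⟨(y.1, y.2 + y.1 • G x0), ?_⟩
    ext <;> simp)
  have hnh : {p : ℂ × B | p.2 ∈ S} ∈ 𝓝 ((0:ℂ), x0) :=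
    (continuous_snd.tendsto ((0:ℂ), x0)).eventually hS
  have him := image_mem_map (m := H) hnh
  have hsurj' : Filter.map H (𝓝 ((0:ℂ), x0)) = 𝓝 (H (0, x0)) := hsurj
  rw [hsurj'] at him
  have hH0 : H (0, x0) = (0, x0) := by simp [H]
  rw [hH0] at him
  obtain ⟨δ, hδ, hb⟩ := Metric.mem_nhds_iff.1 him
  refine ⟨δ, hδ, fun ε hε y hy => ?_⟩
  have hmem : (ε, y) ∈ Metric.ball ((0:ℂ), x0) δ := by
    rw [mem_ball_iff_norm, Prod.norm_def]
    simp [hε, hy]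
  obtain ⟨⟨ε', u⟩, hu, he⟩ := hb hmem
  simp only [H, Prod.mk.injEq] at he
  obtain ⟨rfl, he⟩ := he
  exact ⟨u, hu, by rw [← he]; abel⟩

theorem fce_word_contDiff {r : ℕ} {A : Type*} [NormedRing A] [NormedAlgebra ℂ A] (L : List (Fin r)) :
    ContDiff ℂ ⊤ (fun u : Fin r → A => (L.map u).prod) := by
  induction L with
  | nil => simpa using contDiff_const
  | cons a L ih =>
    simp only [List.map_cons, List.prod_cons]
    exact (contDiff_apply ℂ A a).mul ih

end solve

section CK

variable {r l : ℕ} {V : Type*} [NormedAddCommGroup V] [NormedSpace ℂ V] [FiniteDimensional ℂ V]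

theorem fce_foldr (p : Fin r → (V →L[ℂ] V)) (e : V) (L : List (Fin r)) :
    L.foldr (fun a x => p a x) e = (L.map p).prod e := by
  induction L with
  | nil => simp
  | cons a L ih => simp [ih, mul_apply_eq_comp]

theorem fce_basis (p : Fin r → (V →L[ℂ] V)) (e : V)
    (hspan : Submodule.span ℂ
      {w : V | ∃ L : List (Fin r), w = L.foldr (fun a x => p a x) e} = ⊤) :
    ∃ (n : ℕ) (L : Fin n → List (Fin r)) (b : Module.Basis (Fin n) ℂ V),
      ∀ i, b i = ((L i).map p).prod e := by
  let b0 := Module.Basis.ofSpan hspan.ge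
  have hm : ∀ i, b0 i ∈ {w : V | ∃ L : List (Fin r), w = L.foldr (fun a x => p a x) e} := by
    intro i
    have := Module.Basis.ofSpan_subset hspan.ge
    exact this ⟨i, rfl⟩
  have : Finite _ := Module.Finite.finite_basis b0
  have := Fintype.ofFinite ↑((linearIndepOn_empty ℂ id).extend (Set.empty_subset
    {w : V | ∃ L : List (Fin r), w = L.foldr (fun a x => p a x) e}))
  choose L hL using hm
  let eq := Fintype.equivFin ↑((linearIndepOn_empty ℂ id).extend (Set.empty_subset
    {w : V | ∃ L : List (Fin r), w = L.foldr (fun a x => p a x) e}))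
  refine ⟨_, fun i => L (eq.symm i), b0.reindex eq, fun i => ?_⟩
  rw [Module.Basis.reindex_apply, hL, fce_foldr]

end CK




section CK

variable {r l : ℕ} {V : Type*} [NormedAddCommGroup V] [NormedSpace ℂ V] [FiniteDimensional ℂ V]
variable {n : ℕ} (L : Fin n → List (Fin r)) (b : Module.Basis (Fin n) ℂ V) (e : V) (v : Fin l → V)

/-- coordinate functionals -/
noncomputable def fco (i : Fin n) : V →L[ℂ] ℂ := LinearMap.toContinuousLinearMap (b.coord i)

theorem fco_apply (i : Fin n) (x : V) : fco b i x = b.repr x i := rfl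

variable {A : Type*} [NormedRing A] [NormedAlgebra ℂ A] (CC : (V →L[ℂ] V) →+* A)

/-- the frame operator -/
noncomputable def fT (u : Fin r → A) : A :=
  ∑ i, ((L i).map u).prod * CC ((fco b i).smulRight e)

/-- the nonlinearity -/
noncomputable def fF (j : Fin l) (u : Fin r → A) : A :=
  ∑ i, ∑ s, CC ((fco b i).smulRight (b s)) * Ring.inverse (fT L b e CC u) *
    CC ((fco b s).smulRight (v j)) * ((L i).map u).prod

theorem fT_apply (u : Fin r → (V →L[ℂ] V)) (x : V) :
    fT L b e (RingHom.id _) u x = ∑ i, b.repr x i • ((L i).map u).prod e := by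
  simp [fT, fco_apply, sum_apply]

theorem fT_one {p : Fin r → (V →L[ℂ] V)} (hb : ∀ i, b i = ((L i).map p).prod e) :
    fT L b e (RingHom.id _) p = 1 := by
  ext x
  rw [fT_apply]
  simp only [← hb, b.sum_repr]
  rfl

theorem fT_map {B : Type*} [NormedRing B] [NormedAlgebra ℂ B] (f : A →+* B) (u : Fin r → A) :
    f (fT L b e CC u) = fT L b e (f.comp CC) (fun a => f (u a)) := by
  simp [fT, map_sum, map_mul, map_list_prod, Function.comp_def]

theorem fF_ev (f : A →+* (V →L[ℂ] V)) (hf : f.comp CC = RingHom.id _) (u : Fin r → A) (j : Fin l) :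
    f (fF L b e v CC j u) =
      ∑ i, b.repr (f (Ring.inverse (fT L b e CC u)) (v j)) i • ((L i).map fun a => f (u a)).prod := by
  have hf' : ∀ x, f (CC x) = x := fun x => RingHom.congr_fun hf x
  simp only [fF, map_sum, map_mul, hf', map_list_prod, List.map_map, Function.comp_def]
  refine Finset.sum_congr rfl fun i _ => ?_
  ext x
  simp only [sum_apply, mul_apply_eq_comp, ContinuousLinearMap.smulRight_apply,
    map_smul, fco_apply, smul_apply]
  have : ∀ y : V, ∑ s, b.repr y s • b s = y := b.sum_repr
  conv_rhs => rw [← this (((L i).map fun a => f (u a)).prod x), Finset.smul_sum]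
  refine Finset.sum_congr rfl fun s _ => ?_
  simp [smul_smul, mul_comm]

theorem fF_e (f : A →+* (V →L[ℂ] V)) (hf : f.comp CC = RingHom.id _) (u : Fin r → A)
    (hu : IsUnit (fT L b e CC u)) (j : Fin l) : f (fF L b e v CC j u) e = v j := by
  rw [fF_ev L b e v CC f hf]
  have h1 := congrArg f (Ring.mul_inverse_cancel _ hu)
  rw [map_mul, map_one, fT_map, hf] at h1
  have h2 := congrArg (fun g => g (v j)) h1
  simp only [mul_apply_eq_comp, fT_apply] at h2
  simpa [sum_apply] using h2

theorem fT_contDiff : ContDiff ℂ ⊤ (fT L b e CC) := by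
  unfold fT
  exact ContDiff.sum fun i _ => (fce_word_contDiff _).mul contDiff_const

theorem fF_contDiff [CompleteSpace A] (j : Fin l) {u : Fin r → A} (hu : IsUnit (fT L b e CC u)) :
    ContDiffAt ℂ 1 (fF L b e v CC j) u := by
  have h1 : ContDiffAt ℂ 1 (fun u => Ring.inverse (fT L b e CC u)) u := by
    obtain ⟨x, hx⟩ := hu
    have h2 := contDiffAt_ringInverse ℂ (n := 1) x
    rw [hx] at h2
    exact ContDiffAt.comp u h2 ((fT_contDiff L b e CC).contDiffAt.of_le (by simp))
  unfold fF
  refine ContDiffAt.sum fun i _ => ContDiffAt.sum fun s _ => ?_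
  exact ((contDiffAt_const.mul h1).mul contDiffAt_const).mul
    ((fce_word_contDiff (L i)).contDiffAt.of_le (by simp))

/-- The Banach-space fixed point. -/
theorem fCK_fix {p : Fin r → (V →L[ℂ] V)} (hb : ∀ i, b i = ((L i).map p).prod e) :
    ∃ δ > 0, ∀ ε : ℂ, ‖ε‖ < δ → ∀ y : Fin r → FWA (fWt r l) (V →L[ℂ] V),
      (∀ a, ‖y a - FWA.C (p a)‖ < δ) →
      ∃ u : Fin r → FWA (fWt r l) (V →L[ℂ] V), IsUnit (fT L b e FWA.C u) ∧
        ∀ a, u a = y a + ε • ∑ j, fN a j (fF L b e v FWA.C j u) := by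
  let x0 : Fin r → FWA (fWt r l) (V →L[ℂ] V) := fun a => FWA.C (p a)
  have hT0 : fT L b e FWA.C x0 = 1 := by
    have := fT_map L b e (RingHom.id _) (FWA.C (W := fWt r l)) p
    rw [fT_one L b e hb, map_one] at this
    exact this.symm
  have hu0 : IsUnit (fT L b e FWA.C x0) := by rw [hT0]; exact isUnit_one
  let G : (Fin r → FWA (fWt r l) (V →L[ℂ] V)) → (Fin r → FWA (fWt r l) (V →L[ℂ] V)) :=
    fun u a => ∑ j, fN a j (fF L b e v FWA.C j u)
  have hG : ContDiffAt ℂ 1 G x0 := by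
    rw [contDiffAt_pi]
    intro a
    refine ContDiffAt.sum fun j _ => ?_
    exact (fN a j).contDiff.contDiffAt.comp x0 (fF_contDiff L b e v FWA.C j hu0)
  have hS : {u | IsUnit (fT L b e (FWA.C (W := fWt r l)) u)} ∈ 𝓝 x0 :=
    (fT_contDiff L b e FWA.C).continuous.continuousAt.eventually (Units.isOpen.mem_nhds hu0)
  obtain ⟨δ, hδ, h⟩ := fce_solve hG hS
  refine ⟨δ, hδ, fun ε hε y hy => ?_⟩
  obtain ⟨u, hu, he⟩ := h ε hε y (by
    rw [pi_norm_lt_iff hδ]; exact hy)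
  exact ⟨u, hu, fun a => congrFun he a⟩

end CK




section CK

variable {r l : ℕ} {V : Type*} [NormedAddCommGroup V] [NormedSpace ℂ V] [FiniteDimensional ℂ V]

/-- rescaled coordinates -/
noncomputable def fpsi (r l : ℕ) (κ ε : ℂ) : ((Fin r → ℂ) × (Fin l → ℂ)) →L[ℂ] (Fin r ⊕ Fin l → ℂ) :=
  ContinuousLinearMap.pi (fun i => Sum.elim
    (fun a => κ⁻¹ • (ContinuousLinearMap.proj a).comp (ContinuousLinearMap.fst ℂ _ _))
    (fun j => ε⁻¹ • (ContinuousLinearMap.proj j).comp (ContinuousLinearMap.snd ℂ _ _)) i)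

theorem fpsi_inl (κ ε : ℂ) (p : (Fin r → ℂ) × (Fin l → ℂ)) (a) :
    fpsi r l κ ε p (Sum.inl a) = κ⁻¹ * p.1 a := by simp [fpsi]

theorem fpsi_inr (κ ε : ℂ) (p : (Fin r → ℂ) × (Fin l → ℂ)) (j) :
    fpsi r l κ ε p (Sum.inr j) = ε⁻¹ * p.2 j := by simp [fpsi]

theorem fCK {n : ℕ} (L : Fin n → List (Fin r)) (b : Module.Basis (Fin n) ℂ V) (e : V) (v : Fin l → V)
    (U : Set (Fin r → ℂ)) (hU : IsOpen U) (h0U : (0 : Fin r → ℂ) ∈ U)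
    (Ω : Fin r → (Fin r → ℂ) → (V →L[ℂ] V))
    (hΩhol : ∀ a, DifferentiableOn ℂ (Ω a) U)
    (hb : ∀ i, b i = ((L i).map (fun a => Ω a 0)).prod e) :
    ∃ (u : Fin r → ((Fin r → ℂ) × (Fin l → ℂ)) → (V →L[ℂ] V))
      (φ : Fin l → ((Fin r → ℂ) × (Fin l → ℂ)) → (V →L[ℂ] V))
      (s : Fin n → Fin l → ((Fin r → ℂ) × (Fin l → ℂ)) → ℂ),
      (∀ a, ∀ᶠ p in 𝓝 0, ContDiffAt ℂ 2 (u a) p) ∧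
      (∀ j, ∀ᶠ p in 𝓝 0, ContDiffAt ℂ 2 (φ j) p) ∧
      (∀ a, ∀ᶠ p in 𝓝 0, p.2 = 0 → u a p = Ω a p.1) ∧
      (∀ j, ∀ᶠ p in 𝓝 0, φ j p e = v j) ∧
      (∀ j, ∀ᶠ p in 𝓝 0, φ j p = ∑ i, s i j p • ((L i).map fun a => u a p).prod) ∧
      (∀ i j, s i j =O[𝓝 0] fun _ => (1:ℝ)) ∧
      (∀ a, ∀ᶠ p in 𝓝 0, fderiv ℂ (u a) p (0, p.2) =
        ∑ j, p.2 j • (p.1 a • fderiv ℂ (φ j) p (Pi.single a 1, 0))) := by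
  have h1 : ‖(1 : V →L[ℂ] V)‖ ≤ 1 := ContinuousLinearMap.norm_id_le
  obtain ⟨δ, hδ, hfix⟩ := fCK_fix (l := l) L b e v hb
  obtain ⟨c, hc, hcU⟩ := Metric.isOpen_iff.1 hU 0 h0U
  -- initial data
  have hinit : ∀ a, ∃ F : FWA (fWt r l) (V →L[ℂ] V), ∀ z, (∀ a, ‖z (Sum.inl a)‖ ≤ Real.exp (-1)) →
      (∀ j, ‖z (Sum.inr j)‖ ≤ 1) → F.ev z = Ω a (((c/3 : ℝ) : ℂ) • fun a => z (Sum.inl a)) := by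
    intro a
    refine finit h1 (g := fun q => Ω a (((c/3 : ℝ) : ℂ) • q))
      (O := (fun q : Fin r → ℂ => ((c/3 : ℝ) : ℂ) • q) ⁻¹' U) ?_ ?_ ?_
    · exact hU.preimage (continuous_const_smul _)
    · intro q hq
      apply hcU
      rw [mem_closedBall_zero_iff] at hq
      rw [mem_ball_zero_iff, norm_smul, Complex.norm_real, Real.norm_eq_abs, abs_of_pos (by positivity)]
      nlinarith
    · refine DifferentiableOn.comp (hΩhol a) ?_ (fun q hq => hq)
      have hdl : Differentiable ℂ fun q : Fin r → ℂ => ((c/3 : ℝ) : ℂ) • q := by fun_prop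
      exact hdl.differentiableOn
  choose F hF using hinit
  obtain ⟨ρ, hρ0, hρ1, hρ⟩ : ∃ ρ : ℝ, 0 < ρ ∧ ρ ≤ 1 ∧ ∀ a, ρ * ‖F a‖ < δ := by
    have : ∀ᶠ ρ : ℝ in 𝓝[>] 0, ρ ≤ 1 ∧ ∀ a, ρ * ‖F a‖ < δ := by
      refine ((eventually_le_nhds zero_lt_one).filter_mono nhdsWithin_le_nhds).and ?_
      rw [eventually_all]
      intro a
      have h2 : ContinuousAt (fun ρ : ℝ => ρ * ‖F a‖) 0 := by fun_prop
      exact (h2.eventually_lt (continuousAt_const (y := δ)) (by simpa using hδ)).filter_mono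
        nhdsWithin_le_nhds
    obtain ⟨ρ, h, h'⟩ := (this.and self_mem_nhdsWithin).exists
    exact ⟨ρ, h', h.1, h.2⟩
  choose y hy1 hy2 using fun a => fscale (F a) hρ0.le hρ1
  have hF0 : ∀ a, (F a).ev 0 = Ω a 0 := by
    intro a
    rw [hF a 0 (by simp [Real.exp_nonneg]) (by simp)]
    congr 1
    ext i; simp
  obtain ⟨κ, hκ⟩ : ∃ κ : ℂ, κ = ((c/3 : ℝ) : ℂ) * (ρ : ℂ) := ⟨_, rfl⟩
  have hκ0 : κ ≠ 0 := by
    rw [hκ]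
    exact mul_ne_zero (by exact_mod_cast (by positivity : c/3 ≠ 0)) (by exact_mod_cast hρ0.ne')
  have hyev : ∀ a z, (∀ a, ‖z (Sum.inl a)‖ ≤ Real.exp (-1)) →
      (∀ j, ‖z (Sum.inr j)‖ ≤ 1) → (y a).ev z = Ω a (κ • fun a => z (Sum.inl a)) := by
    intro a z hz1 hz2
    have hn : ‖(ρ:ℂ)‖ ≤ 1 := by
      rw [Complex.norm_real, Real.norm_eq_abs, abs_of_pos hρ0]; exact hρ1
    rw [hy1, hF]
    · congr 1
      ext i; simp [hκ, mul_assoc]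
    · intro i
      simp only [Pi.smul_apply, smul_eq_mul, norm_mul]
      exact (mul_le_of_le_one_left (norm_nonneg _) hn).trans (hz1 i)
    · intro i
      simp only [Pi.smul_apply, smul_eq_mul, norm_mul]
      exact (mul_le_of_le_one_left (norm_nonneg _) hn).trans (hz2 i)
  obtain ⟨ε, hε0, hε⟩ : ∃ ε : ℂ, ε ≠ 0 ∧ ‖ε‖ < δ := by
    refine ⟨((δ/2 : ℝ) : ℂ), by exact_mod_cast (by positivity), ?_⟩
    rw [Complex.norm_real, Real.norm_eq_abs, abs_of_pos (by positivity)]; linarith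
  obtain ⟨u, hu, hue⟩ := hfix ε hε y (fun a => by
    rw [← hF0]; exact (hy2 a).trans_lt (hρ a))
  obtain ⟨Φ, hΦ⟩ : ∃ Φ : Fin l → FWA (fWt r l) (V →L[ℂ] V), ∀ j, Φ j = fF L b e v FWA.C j u :=
    ⟨_, fun _ => rfl⟩
  simp only [← hΦ] at hue
  let ψ := fpsi r l κ ε
  -- good set
  have hexp : Real.exp (-1) ≤ 1 := by simp
  have hexp0 := Real.exp_pos (-1)
  have hgood : ∀ z : Fin r ⊕ Fin l → ℂ, ‖z‖ < Real.exp (-1) →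
      (∀ a, ‖z (Sum.inl a)‖ ≤ Real.exp (-1)) ∧ (∀ j, ‖z (Sum.inr j)‖ ≤ 1) := fun z hz =>
    ⟨fun a => (norm_le_pi_norm z _).trans hz.le,
      fun j => ((norm_le_pi_norm z _).trans hz.le).trans hexp⟩
  have hadm : ∀ z : Fin r ⊕ Fin l → ℂ, ‖z‖ < Real.exp (-1) → (fWt r l).Adm z := fun z hz =>
    fWt_adm (hgood z hz).1 (hgood z hz).2
  have hball : ∀ z : Fin r ⊕ Fin l → ℂ, ‖z‖ < Real.exp (-1) →
      ∀ w ∈ Metric.ball z (Real.exp (-1) - ‖z‖), ‖w‖ < Real.exp (-1) := by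
    intro z hz w hw
    rw [mem_ball_iff_norm] at hw
    have := norm_sub_norm_le w z
    linarith
  have hcd : ∀ (x : FWA (fWt r l) (V →L[ℂ] V)) (z : Fin r ⊕ Fin l → ℂ), ‖z‖ < Real.exp (-1) →
      ∀ k : ℕ, ContDiffAt ℂ k x.ev z := fun x z hz k =>
    x.ev_contDiffAt (sub_pos.2 hz) (fun w hw => hadm w (hball z hz w hw)) k
  have hev : ∀ᶠ p in 𝓝 (0 : (Fin r → ℂ) × (Fin l → ℂ)), ‖ψ p‖ < Real.exp (-1) := by
    have : ContinuousAt (fun p => ‖ψ p‖) (0 : (Fin r → ℂ) × (Fin l → ℂ)) :=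
      ψ.continuous.norm.continuousAt
    exact this.eventually_lt continuousAt_const (by simpa using hexp0)
  have hid : ∀ {z} (hz : (fWt r l).Adm z),
      (FWA.evHom (R := V →L[ℂ] V) hz).comp FWA.C = RingHom.id _ := fun hz =>
    RingHom.ext fun x => FWA.ev_C x _
  refine ⟨fun a p => (u a).ev (ψ p), fun j p => (Φ j).ev (ψ p),
    fun i j p => b.repr ((Ring.inverse (fT L b e FWA.C u)).ev (ψ p) (v j)) i, ?_, ?_, ?_, ?_, ?_, ?_, ?_⟩
  · intro a
    filter_upwards [hev] with p hp
    exact (hcd (u a) _ hp 2).comp p ψ.contDiff.contDiffAt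
  · intro j
    filter_upwards [hev] with p hp
    exact (hcd (Φ j) _ hp 2).comp p ψ.contDiff.contDiffAt
  · intro a
    filter_upwards [hev] with p hp hp0
    have hz := hadm _ hp
    have h2 : (u a).ev (ψ p) = (y a).ev (ψ p) := by
      rw [hue a]
      change FWA.evL hz _ = FWA.evL hz _
      rw [map_add, map_smul, map_sum]
      have : ∀ j, FWA.evL hz (fN a j (Φ j)) = 0 := fun j => by
        refine fN_init a j (Φ j) fun k => ?_
        rw [fpsi_inr, hp0]; simp
      simp [this]
    rw [h2, hyev a _ (hgood _ hp).1 (hgood _ hp).2]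
    congr 1
    ext i
    simp only [Pi.smul_apply, smul_eq_mul, ψ, fpsi_inl]
    rw [mul_inv_cancel_left₀ hκ0]
  · intro j
    filter_upwards [hev] with p hp
    rw [hΦ]
    exact fF_e L b e v FWA.C (FWA.evHom (hadm _ hp)) (hid _) u hu j
  · intro j
    filter_upwards [hev] with p hp
    rw [hΦ]
    exact fF_ev L b e v FWA.C (FWA.evHom (hadm _ hp)) (hid _) u j
  · intro i j
    refine IsBigO.of_bound (‖fco b i‖ * (‖Ring.inverse (fT L b e FWA.C u)‖ * ‖v j‖)) ?_
    filter_upwards [hev] with p hp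
    rw [norm_one, mul_one]
    calc _ ≤ ‖fco b i‖ * ‖(Ring.inverse (fT L b e FWA.C u)).ev (ψ p) (v j)‖ :=
          (fco b i).le_opNorm _
      _ ≤ _ := by
          gcongr
          refine (ContinuousLinearMap.le_opNorm _ _).trans ?_
          gcongr
          exact FWA.ev_norm _ (hadm _ hp)
  · intro a
    filter_upwards [hev] with p hp
    have hd : ∀ x : FWA (fWt r l) (V →L[ℂ] V), HasFDerivAt x.ev (fderiv ℂ x.ev (ψ p)) (ψ p) :=
      fun x => ((hcd x _ hp 1).differentiableAt (by simp)).hasFDerivAt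
    have hch : ∀ (x : FWA (fWt r l) (V →L[ℂ] V)) w,
        fderiv ℂ (fun p => x.ev (ψ p)) p w = fderiv ℂ x.ev (ψ p) (ψ w) := by
      intro x w
      have h3 : HasFDerivAt (fun p => x.ev (ψ p)) ((fderiv ℂ x.ev (ψ p)).comp ψ) p :=
        HasFDerivAt.comp (g := x.ev) p (hd x) ψ.hasFDerivAt
      rw [h3.fderiv]; rfl
    have hnear : ∀ᶠ z in 𝓝 (ψ p), (fWt r l).Adm z := by
      refine mem_of_superset (Metric.ball_mem_nhds _ (sub_pos.2 hp)) fun w hw => ?_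
      exact hadm w (hball _ hp w hw)
    have hsplit : fderiv ℂ (u a).ev (ψ p) =
        fderiv ℂ (y a).ev (ψ p) + ε • ∑ j, fderiv ℂ (fN a j (Φ j)).ev (ψ p) := by
      have h4 : (u a).ev =ᶠ[𝓝 (ψ p)] fun z => (y a).ev z + ε • ∑ j, (fN a j (Φ j)).ev z := by
        filter_upwards [hnear] with z hz
        rw [hue a]
        change FWA.evL hz _ = FWA.evL hz _ + _
        rw [map_add, map_smul, map_sum]
        rfl
      have h5 : HasFDerivAt (fun z => (y a).ev z + ε • ∑ j, (fN a j (Φ j)).ev z)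
          (fderiv ℂ (y a).ev (ψ p) + ε • ∑ j, fderiv ℂ (fN a j (Φ j)).ev (ψ p)) (ψ p) :=
        (hd (y a)).add ((HasFDerivAt.fun_sum fun j _ => hd (fN a j (Φ j))).const_smul ε)
      rw [h4.fderiv_eq, h5.fderiv]
    have hψ0 : ψ (0, p.2) = (Sum.elim 0 (fun k => ψ p (Sum.inr k)) : Fin r ⊕ Fin l → ℂ) := by
      funext i
      cases i with
      | inl i => simp [ψ, fpsi_inl]
      | inr i => simp [ψ, fpsi_inr]
    have hy0 : fderiv ℂ (y a).ev (ψ p) (ψ (0, p.2)) = 0 := by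
      have hl : HasDerivAt (fun s : ℂ => ψ p + s • ψ (0, p.2)) (ψ (0, p.2)) 0 := by
        simpa using! ((hasDerivAt_id (0:ℂ)).smul_const (ψ (0, p.2))).const_add (ψ p)
      have h6 : HasDerivAt (fun s : ℂ => (y a).ev (ψ p + s • ψ (0, p.2)))
          (fderiv ℂ (y a).ev (ψ p) (ψ (0, p.2))) 0 := by
        refine HasFDerivAt.comp_hasDerivAt (l := (y a).ev) (0:ℂ) ?_ hl
        simpa using hd (y a)
      have h7 : (fun s : ℂ => (y a).ev (ψ p + s • ψ (0, p.2))) =ᶠ[𝓝 0]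
          fun _ => Ω a (κ • fun i => ψ p (Sum.inl i)) := by
        have hcont : ContinuousAt (fun s : ℂ => ‖ψ p + s • ψ (0, p.2)‖) 0 :=
          hl.continuousAt.norm
        filter_upwards [hcont.eventually_lt (continuousAt_const (y := Real.exp (-1))) (by simpa using hp)] with s hs
        rw [hyev a _ (hgood _ hs).1 (hgood _ hs).2]
        congr 2
        funext i
        simp [hψ0]
      exact h6.unique ((hasDerivAt_const (0:ℂ) _).congr_of_eventuallyEq h7)
    rw [hch, hsplit]
    simp only [add_apply, smul_apply, sum_apply, hy0, zero_add, hch]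
    rw [Finset.smul_sum]
    refine Finset.sum_congr rfl fun j _ => ?_
    rw [hψ0, fN_euler a j (Φ j) (sub_pos.2 hp) (fun w hw => hadm w (hball _ hp w hw))]
    rw [smul_smul]
    have h8 : ε * ψ p (Sum.inr j) = p.2 j := by
      simp only [ψ, fpsi_inr]; rw [mul_inv_cancel_left₀ hε0]
    rw [h8]
    congr 1
    rw [← map_smul, ← map_smul]
    congr 1
    funext i
    cases i with
    | inl i =>
      by_cases hi : i = a
      · subst hi; simp [ψ, fpsi_inl, mul_comm]
      · simp [ψ, fpsi_inl, hi]
    | inr i => simp [ψ, fpsi_inr]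

end CK




section germ

/-- base space -/
abbrev fZ (r l : ℕ) : Type := (Fin r → ℂ) × (Fin l → ℂ)

variable {r l : ℕ} {F : Type*} [NormedAddCommGroup F] [NormedSpace ℂ F]

/-- germ-holomorphic -/
def fHol (f : fZ r l → F) : Prop := ∀ᶠ p in 𝓝 (0 : fZ r l), DifferentiableAt ℂ f p

/-- order in t -/
def ford (k : ℕ) (f : fZ r l → F) : Prop := f =O[𝓝 0] fun p : fZ r l => ‖p.2‖ ^ k

theorem fHol.ord0 {f : fZ r l → F} (h : fHol f) : ford 0 f := by
  have := h.self_of_nhds.continuousAt.isBigO_one ℝ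
  simpa [ford] using! this

theorem ford.add {k} {f g : fZ r l → F} (hf : ford k f) (hg : ford k g) :
    ford k (fun p => f p + g p) := IsBigO.add hf hg

theorem ford.sub {k} {f g : fZ r l → F} (hf : ford k f) (hg : ford k g) :
    ford k (fun p => f p - g p) := IsBigO.sub hf hg

theorem ford.neg {k} {f : fZ r l → F} (hf : ford k f) :
    ford k (fun p => - f p) := IsBigO.neg_left hf

theorem ford.sum {k} {ι : Type*} {s : Finset ι} {f : ι → fZ r l → F} (hf : ∀ i ∈ s, ford k (f i)) :
    ford k (fun p => ∑ i ∈ s, f i p) := IsBigO.fun_sum hf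

theorem ford.congr {k} {f g : fZ r l → F} (hf : ford k f) (h : g =ᶠ[𝓝 0] f) : ford k g :=
  IsBigO.congr' hf h.symm EventuallyEq.rfl

theorem ford_zero {k} {f : fZ r l → F} (h : ∀ᶠ p in 𝓝 (0 : fZ r l), f p = 0) : ford k f := by
  refine ford.congr (f := fun _ => 0) ?_ h
  exact isBigO_zero _ _

theorem ford.mul_left {A : Type*} [NormedRing A] {k} {f g : fZ r l → A}
    (hf : ford 0 f) (hg : ford k g) : ford k (fun p => f p * g p) := by
  have := IsBigO.mul hf hg
  simpa [ford] using this

theorem ford.mul_right {A : Type*} [NormedRing A] {k} {f g : fZ r l → A}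
    (hf : ford k f) (hg : ford 0 g) : ford k (fun p => f p * g p) := by
  have := IsBigO.mul hf hg
  simpa [ford] using this

theorem ford.smul {k} {s : fZ r l → ℂ} {f : fZ r l → F}
    (hs : ford 0 s) (hf : ford k f) : ford k (fun p => s p • f p) := by
  have := IsBigO.smul hs hf
  simpa [ford] using this

theorem ford.tsmul {k} {f : fZ r l → F} (j : Fin l) (hf : ford k f) :
    ford (k+1) (fun p => p.2 j • f p) := by
  have h1 : (fun p : fZ r l => p.2 j) =O[𝓝 0] fun p => ‖p.2‖ := by
    refine IsBigO.of_bound 1 (Eventually.of_forall fun p => ?_)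
    simpa using norm_le_pi_norm p.2 j
  have := IsBigO.smul h1 hf
  refine this.congr_right fun p => ?_
  simp [pow_succ, mul_comm]

theorem fHol.ball {f : fZ r l → F} (h : fHol f) : ∃ ρ > 0, ∀ p : fZ r l, ‖p‖ < ρ → DifferentiableAt ℂ f p := by
  obtain ⟨ρ, hρ, hb⟩ := Metric.eventually_nhds_iff.1 h
  exact ⟨ρ, hρ, fun p hp => hb (by simpa using hp)⟩

theorem ford.ball {f : fZ r l → F} {k} (h : ford k f) :
    ∃ C ≥ 0, ∃ ρ > 0, ∀ p : fZ r l, ‖p‖ < ρ → ‖f p‖ ≤ C * ‖p.2‖ ^ k := by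
  obtain ⟨C, hC, hb⟩ := h.exists_nonneg
  rw [isBigOWith_iff] at hb
  obtain ⟨ρ, hρ, hb⟩ := Metric.eventually_nhds_iff.1 hb
  refine ⟨C, hC, ρ, hρ, fun p hp => ?_⟩
  simpa using hb (y := p) (by simpa using hp)

theorem ford_of_ball {f : fZ r l → F} {k} {C ρ : ℝ} (hρ : 0 < ρ)
    (h : ∀ p : fZ r l, ‖p‖ < ρ → ‖f p‖ ≤ C * ‖p.2‖ ^ k) : ford k f := by
  refine IsBigO.of_bound C ?_
  refine Metric.eventually_nhds_iff.2 ⟨ρ, hρ, fun p hp => ?_⟩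
  simpa using h p (by simpa using hp)

/-- Lemma (a): horizontal derivatives preserve the order. -/
theorem ford.hderiv {f : fZ r l → F} {k} (hf : fHol f) (ho : ford k f) (w : Fin r → ℂ) :
    ford k (fun p => fderiv ℂ f p (w, 0)) := by
  obtain ⟨ρ1, hρ1, hd⟩ := hf.ball
  obtain ⟨C, hC, ρ2, hρ2, hb⟩ := ho.ball
  obtain ⟨ρ, hρ, h1, h2⟩ : ∃ ρ > 0, ρ ≤ ρ1 ∧ ρ ≤ ρ2 :=
    ⟨min ρ1 ρ2, lt_min hρ1 hρ2, min_le_left _ _, min_le_right _ _⟩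
  obtain ⟨η, hη, hηw⟩ : ∃ η > 0, η * ‖w‖ ≤ ρ / 2 := by
    refine ⟨ρ / 2 / (‖w‖ + 1), by positivity, ?_⟩
    rw [div_mul_eq_mul_div, div_le_iff₀ (by positivity)]
    nlinarith [norm_nonneg w]
  refine ford_of_ball (C := 2 * C / η) (half_pos hρ) fun p hp => ?_
  have hin : ∀ s ∈ Metric.ball (0:ℂ) η, ‖p + s • ((w, 0) : fZ r l)‖ < ρ := by
    intro s hs
    rw [mem_ball_zero_iff] at hs
    calc _ ≤ ‖p‖ + ‖s • ((w, 0) : fZ r l)‖ := norm_add_le _ _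
      _ = ‖p‖ + ‖s‖ * ‖w‖ := by rw [norm_smul, Prod.norm_def]; simp
      _ < ρ := by nlinarith [norm_nonneg w]
  have hg : ∀ s ∈ Metric.ball (0:ℂ) η,
      HasDerivAt (fun s : ℂ => f (p + s • ((w, 0) : fZ r l))) (fderiv ℂ f (p + s • ((w, 0) : fZ r l)) (w, 0)) s := by
    intro s hs
    refine HasFDerivAt.comp_hasDerivAt (l := f) s (hd _ ((hin s hs).trans_le h1)).hasFDerivAt ?_
    simpa using! ((hasDerivAt_id s).smul_const ((w, 0) : fZ r l)).const_add p
  have := fce_fderiv_bound (f := fun s : ℂ => f (p + s • ((w, 0) : fZ r l))) (x := 0)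
    (M := C * ‖p.2‖ ^ k) hη (fun s hs => (hg s hs).differentiableAt.differentiableWithinAt)
    (fun s hs => by simpa using hb _ ((hin s hs).trans_le h2))
  have h3 := hg 0 (Metric.mem_ball_self hη)
  rw [h3.hasFDerivAt.fderiv] at this
  simp only [ContinuousLinearMap.norm_toSpanSingleton, zero_smul, add_zero] at this
  calc _ ≤ _ := this
    _ = _ := by ring

theorem f_segment {E : Type*} [NormedAddCommGroup E] [NormedSpace ℝ E] {h h' : ℝ → E} {M : ℝ}
    (hd : ∀ s ∈ Set.Ioc (0:ℝ) 1, HasDerivAt h (h' s) s) (hc : ContinuousAt h 0) (h0 : h 0 = 0)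
    (hb : ∀ s ∈ Set.Ioc (0:ℝ) 1, ‖h' s‖ ≤ M) : ‖h 1‖ ≤ M := by
  have hM : 0 ≤ M := (norm_nonneg _).trans (hb 1 (by simp))
  have h1 : ∀ s ∈ Set.Ioc (0:ℝ) 1, ‖h 1 - h s‖ ≤ M := by
    intro s hs
    have := Convex.norm_image_sub_le_of_norm_hasDerivWithin_le (f := h) (f' := h') (C := M)
      (s := Set.Ioc (0:ℝ) 1) (fun x hx => (hd x hx).hasDerivWithinAt) hb (convex_Ioc 0 1) hs
      (y := 1) (by simp)
    refine this.trans ?_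
    rw [Real.norm_eq_abs, abs_of_nonneg (by linarith [hs.2])]
    nlinarith [hs.1]
  have ht : Tendsto (fun s => ‖h 1 - h s‖) (𝓝[>] 0) (𝓝 ‖h 1 - h 0‖) :=
    ((continuousAt_const.sub hc).norm).tendsto.mono_left nhdsWithin_le_nhds
  rw [h0, sub_zero] at ht
  refine le_of_tendsto ht ?_
  filter_upwards [Ioc_mem_nhdsGT (zero_lt_one (α := ℝ))] with s hs using h1 s hs

/-- curve derivative -/
theorem f_curve {f : fZ r l → F} (p : fZ r l) (s : ℝ) (hd : DifferentiableAt ℂ f (p.1, (s:ℂ) • p.2)) :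
    HasDerivAt (fun s : ℝ => f (p.1, (s:ℂ) • p.2)) (fderiv ℂ f (p.1, (s:ℂ) • p.2) (0, p.2)) s := by
  have h1 : HasDerivAt (fun z : ℂ => f (p.1, z • p.2)) (fderiv ℂ f (p.1, (s:ℂ) • p.2) (0, p.2)) (s:ℂ) := by
    refine HasFDerivAt.comp_hasDerivAt (l := f) (s:ℂ) hd.hasFDerivAt ?_
    refine (hasDerivAt_const _ _).prodMk ?_
    simpa using! (hasDerivAt_id (s:ℂ)).smul_const p.2
  have h2 := h1.scomp s (Complex.ofRealCLM.hasDerivAt (x := s))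
  simpa [Function.comp_def] using! h2

theorem f_curve_norm (p : fZ r l) {s : ℝ} (h0 : 0 ≤ s) (h1 : s ≤ 1) :
    ‖((p.1, (s:ℂ) • p.2) : fZ r l)‖ ≤ ‖p‖ := by
  rw [Prod.norm_def, Prod.norm_def]
  refine max_le_max le_rfl ?_
  simp only [norm_smul, Complex.norm_real, Real.norm_eq_abs, abs_of_nonneg h0]
  exact mul_le_of_le_one_left (norm_nonneg _) h1

/-- Lemma (b). -/
theorem ford_of_euler {f : fZ r l → F} {k} (hf : fHol f)
    (h0 : ∀ᶠ p in 𝓝 (0 : fZ r l), p.2 = 0 → f p = 0)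
    (hE : ford (k+1) (fun p => fderiv ℂ f p (0, p.2))) : ford (k+1) f := by
  obtain ⟨ρ1, hρ1, hd⟩ := hf.ball
  obtain ⟨C, hC, ρ2, hρ2, hb⟩ := hE.ball
  obtain ⟨ρ3, hρ3, h0⟩ := Metric.eventually_nhds_iff.1 h0
  refine ford_of_ball (C := C) (lt_min (lt_min hρ1 hρ2) hρ3) fun p hp => ?_
  have hp1 : ‖p‖ < ρ1 := hp.trans_le ((min_le_left _ _).trans (min_le_left _ _))
  have hp2 : ‖p‖ < ρ2 := hp.trans_le ((min_le_left _ _).trans (min_le_right _ _))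
  have hp3 : ‖p‖ < ρ3 := hp.trans_le (min_le_right _ _)
  have hdc : ∀ s : ℝ, 0 ≤ s → s ≤ 1 → HasDerivAt (fun s : ℝ => f (p.1, (s:ℂ) • p.2))
      (fderiv ℂ f (p.1, (s:ℂ) • p.2) (0, p.2)) s := fun s hs hs1 =>
    f_curve p s (hd _ ((f_curve_norm p hs hs1).trans_lt hp1))
  have := f_segment (h := fun s : ℝ => f (p.1, (s:ℂ) • p.2))
    (h' := fun s : ℝ => fderiv ℂ f (p.1, (s:ℂ) • p.2) (0, p.2)) (M := C * ‖p.2‖ ^ (k+1))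
    (fun s hs => hdc s hs.1.le hs.2) (hdc 0 le_rfl zero_le_one).continuousAt ?_ ?_
  · simpa using this
  · refine h0 ?_ ?_
    · rw [dist_zero_right]
      exact (f_curve_norm p le_rfl zero_le_one).trans_lt hp3
    · simp
  · intro s hs
    have h4 := hb _ ((f_curve_norm p hs.1.le hs.2).trans_lt hp2)
    have e1 : ((0, (s:ℂ) • p.2) : fZ r l) = (s:ℂ) • (0, p.2) := by simp
    simp only at h4
    rw [e1, map_smul, norm_smul, norm_smul, Complex.norm_real, Real.norm_eq_abs, abs_of_pos hs.1] at h4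
    have h5 : s * ‖fderiv ℂ f (p.1, (s:ℂ) • p.2) (0, p.2)‖ ≤ s * (C * ‖p.2‖ ^ (k+1)) := by
      refine h4.trans ?_
      rw [mul_pow, pow_succ s]
      have : s ^ k ≤ 1 := pow_le_one₀ hs.1.le hs.2
      calc C * (s ^ k * s * ‖p.2‖ ^ (k+1)) = s ^ k * (s * (C * ‖p.2‖ ^ (k+1))) := by ring
        _ ≤ 1 * (s * (C * ‖p.2‖ ^ (k+1))) := by
            have := hs.1.le
            gcongr
        _ = _ := one_mul _
    exact le_of_mul_le_mul_left h5 hs.1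

/-- Lemma (b2). -/
theorem ford_of_euler_one {f : fZ r l → F} {k} (hf : fHol f)
    (hE : ford (k+1) (fun p => fderiv ℂ f p (0, p.2) + f p)) : ford (k+1) f := by
  obtain ⟨ρ1, hρ1, hd⟩ := hf.ball
  obtain ⟨C, hC, ρ2, hρ2, hb⟩ := hE.ball
  refine ford_of_ball (C := C) (lt_min hρ1 hρ2) fun p hp => ?_
  have hp1 : ‖p‖ < ρ1 := hp.trans_le (min_le_left _ _)
  have hp2 : ‖p‖ < ρ2 := hp.trans_le (min_le_right _ _)
  have hdc : ∀ s : ℝ, 0 ≤ s → s ≤ 1 → HasDerivAt (fun s : ℝ => s • f (p.1, (s:ℂ) • p.2))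
      (s • fderiv ℂ f (p.1, (s:ℂ) • p.2) (0, p.2) + (1:ℝ) • f (p.1, (s:ℂ) • p.2)) s := fun s hs hs1 =>
    (hasDerivAt_id s).smul (f_curve p s (hd _ ((f_curve_norm p hs hs1).trans_lt hp1)))
  have := f_segment (h := fun s : ℝ => s • f (p.1, (s:ℂ) • p.2))
    (h' := fun s : ℝ => s • fderiv ℂ f (p.1, (s:ℂ) • p.2) (0, p.2) + (1:ℝ) • f (p.1, (s:ℂ) • p.2))
    (M := C * ‖p.2‖ ^ (k+1))
    (fun s hs => hdc s hs.1.le hs.2) (hdc 0 le_rfl zero_le_one).continuousAt (by simp) ?_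
  · simpa using this
  · intro s hs
    have h4 := hb _ ((f_curve_norm p hs.1.le hs.2).trans_lt hp2)
    have e1 : ((0, (s:ℂ) • p.2) : fZ r l) = (s:ℂ) • (0, p.2) := by simp
    simp only at h4
    rw [e1, map_smul, norm_smul, Complex.norm_real, Real.norm_eq_abs, abs_of_pos hs.1] at h4
    rw [one_smul]
    refine h4.trans ?_
    rw [mul_pow]
    have : s ^ (k+1) ≤ 1 := pow_le_one₀ hs.1.le hs.2
    have h6 : s ^ (k+1) * ‖p.2‖ ^ (k+1) ≤ ‖p.2‖ ^ (k+1) :=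
      mul_le_of_le_one_left (by positivity) this
    exact mul_le_mul_of_nonneg_left h6 hC

/-- Lemma (c). -/
theorem ford_eq_zero [CompleteSpace F] {f : fZ r l → F} (hf : fHol f) (ho : ∀ k, ford (k+1) f) :
    ∀ᶠ p in 𝓝 (0 : fZ r l), f p = 0 := by
  obtain ⟨ρ, hρ, hd⟩ := hf.ball
  refine Metric.eventually_nhds_iff.2 ⟨ρ, hρ, fun p hp => ?_⟩
  rw [dist_zero_right] at hp
  let D : Set ℂ := {s : ℂ | ‖s • p‖ < ρ}
  have hDo : IsOpen D := isOpen_lt (by fun_prop) continuous_const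
  have hDc : IsPreconnected D := by
    have : Convex ℝ D := by
      have h1 : D = (ContinuousLinearMap.toSpanSingleton ℂ p).restrictScalars ℝ ⁻¹' Metric.ball 0 ρ := by
        ext s; simp [D]
      rw [h1]
      exact (convex_ball (0 : fZ r l) ρ).linear_preimage
        ((ContinuousLinearMap.toSpanSingleton ℂ p).restrictScalars ℝ).toLinearMap
    exact this.isPreconnected
  have h0D : (0:ℂ) ∈ D := by simpa [D] using hρ
  have h1D : (1:ℂ) ∈ D := by simpa [D] using hp
  have hdiff : DifferentiableOn ℂ (fun s : ℂ => f (s • p)) D := by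
    intro s hs
    refine DifferentiableAt.differentiableWithinAt ?_
    exact DifferentiableAt.comp (g := f) s (hd _ hs) (by fun_prop)
  have han := hdiff.analyticOnNhd hDo
  have hO : ∀ k : ℕ, (fun s : ℂ => f (s • p)) =O[𝓝 0] fun s => s ^ (k+1) := by
    intro k
    have ht : Tendsto (fun s : ℂ => s • p) (𝓝 0) (𝓝 0) := by
      have : Continuous fun s : ℂ => s • p := by fun_prop
      simpa using this.tendsto 0
    refine ((ho k).comp_tendsto ht).trans ?_
    refine IsBigO.of_bound (‖p.2‖ ^ (k+1)) (Eventually.of_forall fun s => ?_)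
    simp [norm_smul, mul_pow, mul_comm]
  have hz : ∀ᶠ s in 𝓝 (0:ℂ), f (s • p) = 0 := by
    by_contra hne
    obtain ⟨n, g, hg, hg0, he⟩ := ((han 0 h0D).exists_eventuallyEq_pow_smul_nonzero_iff).2 hne
    have h2 := hO n
    have h3 : g =O[𝓝[≠] 0] fun s : ℂ => s := by
      obtain ⟨C, hC⟩ := h2.bound
      refine IsBigO.of_bound C ?_
      filter_upwards [hC.filter_mono nhdsWithin_le_nhds, he.filter_mono nhdsWithin_le_nhds,
        self_mem_nhdsWithin] with s h4 h5 h6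
      rw [h5, sub_zero, norm_smul, pow_succ, norm_mul] at h4
      have h7 : 0 < ‖s ^ n‖ := norm_pos_iff.2 (pow_ne_zero _ h6)
      refine le_of_mul_le_mul_left (h4.trans (le_of_eq ?_)) h7
      ring
    have h8 : Tendsto g (𝓝[≠] 0) (𝓝 0) :=
      h3.trans_tendsto (tendsto_id.mono_left nhdsWithin_le_nhds)
    have h9 : Tendsto g (𝓝[≠] 0) (𝓝 (g 0)) := hg.continuousAt.tendsto.mono_left nhdsWithin_le_nhds
    exact hg0 (tendsto_nhds_unique h9 h8)
  have := han.eqOn_zero_of_preconnected_of_eventuallyEq_zero hDc h0D hz h1D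
  simpa using this

end germ




section fields

variable {r l : ℕ} {F : Type*} [NormedAddCommGroup F] [NormedSpace ℂ F]

/-- derivative along a vector field -/
noncomputable def fDx (X : fZ r l → fZ r l) (f : fZ r l → F) (p : fZ r l) : F := fderiv ℂ f p (X p)

/-- Euler field in t -/
noncomputable def XE : fZ r l →L[ℂ] fZ r l :=
  ContinuousLinearMap.prod 0 (ContinuousLinearMap.snd ℂ _ _)

/-- log fields -/
noncomputable def XD (a : Fin r) : fZ r l →L[ℂ] fZ r l :=
  ((ContinuousLinearMap.proj a).comp (ContinuousLinearMap.fst ℂ (Fin r → ℂ) (Fin l → ℂ))).smulRight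
    ((Pi.single a 1, 0) : fZ r l)

/-- coordinate fields -/
noncomputable def XT (j : Fin l) : fZ r l → fZ r l := fun _ => (0, Pi.single j 1)

theorem XE_apply (p : fZ r l) : XE p = (0, p.2) := rfl
theorem XD_apply (a) (p : fZ r l) : XD a p = p.1 a • ((Pi.single a 1, 0) : fZ r l) := rfl

theorem fDx_XD (a) (f : fZ r l → F) (p) : fDx (XD a) f p = p.1 a • fderiv ℂ f p (Pi.single a 1, 0) := by
  rw [fDx, XD_apply, map_smul]

theorem fDx_XE (f : fZ r l → F) (p) : fDx XE f p = ∑ j, p.2 j • fDx (XT j) f p := by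
  simp only [fDx, XT, ← map_smul, ← map_sum]
  congr 1
  rw [XE_apply]
  ext i
  · simp [Prod.fst_sum]
  · simp [Prod.snd_sum, Finset.sum_apply, Pi.single_apply]

theorem fDx_congr {G : Set (fZ r l)} (hG : IsOpen G) {f g : fZ r l → F} (h : ∀ p ∈ G, f p = g p)
    (X) : ∀ p ∈ G, fDx X f p = fDx X g p := by
  intro p hp
  have : f =ᶠ[𝓝 p] g := by
    filter_upwards [hG.mem_nhds hp] with x hx using h x hx
  rw [fDx, fDx, this.fderiv_eq]

theorem fDx_hasFDerivAt {f : fZ r l → F} {p} (hf : ContDiffAt ℂ 2 f p) {Y : fZ r l → fZ r l} {Y' : fZ r l →L[ℂ] fZ r l}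
    (hY : HasFDerivAt Y Y' p) :
    HasFDerivAt (fDx Y f) ((fderiv ℂ f p).comp Y' + (fderiv ℂ (fderiv ℂ f) p).flip (Y p)) p := by
  have h1 : HasFDerivAt (fderiv ℂ f) (fderiv ℂ (fderiv ℂ f) p) p :=
    ((hf.fderiv_right (m := 1) (by norm_num)).differentiableAt (by simp)).hasFDerivAt
  exact h1.clm_apply hY

theorem fDx_fD {f : fZ r l → F} {p} (hf : ContDiffAt ℂ 2 f p) {Y : fZ r l → fZ r l} {Y' : fZ r l →L[ℂ] fZ r l}
    (hY : HasFDerivAt Y Y' p) (X) :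
    fDx X (fDx Y f) p = fderiv ℂ (fderiv ℂ f) p (X p) (Y p) + fderiv ℂ f p (Y' (X p)) := by
  rw [fDx, (fDx_hasFDerivAt hf hY).fderiv]
  simp [add_comm]

theorem fDx_comm {f : fZ r l → F} {p} (hf : ContDiffAt ℂ 2 f p) {X Y : fZ r l → fZ r l} {X' Y' : fZ r l →L[ℂ] fZ r l}
    (hX : HasFDerivAt X X' p) (hY : HasFDerivAt Y Y' p) :
    fDx X (fDx Y f) p = fDx Y (fDx X f) p + fderiv ℂ f p (Y' (X p)) - fderiv ℂ f p (X' (Y p)) := by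
  have hs : IsSymmSndFDerivAt ℂ f p := hf.isSymmSndFDerivAt (by simp)
  rw [fDx_fD hf hY, fDx_fD hf hX, hs.eq (X p) (Y p)]
  abel

theorem fDx_E_D {f : fZ r l → F} {p} (hf : ContDiffAt ℂ 2 f p) (a) :
    fDx XE (fDx (XD a) f) p = fDx (XD a) (fDx XE f) p := by
  rw [fDx_comm hf (XE.hasFDerivAt) ((XD a).hasFDerivAt)]
  have h1 : XD a (XE p) = 0 := by simp [XD_apply, XE_apply]
  have h2 : XE (XD a p) = 0 := by simp [XD_apply, XE_apply]
  rw [h1, h2]; simp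

theorem fDx_D_D {f : fZ r l → F} {p} (hf : ContDiffAt ℂ 2 f p) (a b) :
    fDx (XD b) (fDx (XD a) f) p = fDx (XD a) (fDx (XD b) f) p := by
  by_cases hab : a = b
  · rw [hab]
  rw [fDx_comm hf ((XD b).hasFDerivAt) ((XD a).hasFDerivAt)]
  have h1 : XD a (XD b p) = 0 := by simp [XD_apply, Pi.single_apply, hab]
  have h2 : XD b (XD a p) = 0 := by simp [XD_apply, Pi.single_apply, Ne.symm hab]
  rw [h1, h2]; simp

theorem fDx_T_D {f : fZ r l → F} {p} (hf : ContDiffAt ℂ 2 f p) (a j) :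
    fDx (XT j) (fDx (XD a) f) p = fDx (XD a) (fDx (XT j) f) p := by
  rw [fDx_comm hf (X := XT j) (X' := 0) (hasFDerivAt_const (c := ((0, Pi.single j 1) : fZ r l)) p) ((XD a).hasFDerivAt)]
  have h1 : XD a (XT j p) = 0 := by simp [XD_apply, XT]
  rw [h1]; simp

theorem fDx_T_E {f : fZ r l → F} {p} (hf : ContDiffAt ℂ 2 f p) (j) :
    fDx (XT j) (fDx XE f) p = fDx XE (fDx (XT j) f) p + fDx (XT j) f p := by
  rw [fDx_comm hf (X := XT j) (X' := 0) (hasFDerivAt_const (c := ((0, Pi.single j 1) : fZ r l)) p) (XE.hasFDerivAt)]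
  have h1 : XE (XT j p) = XT j p := by simp [XE_apply, XT]
  rw [h1]; simp [fDx]

theorem fDx_diff {f : fZ r l → F} {p} (hf : ContDiffAt ℂ 2 f p) {Y : fZ r l → fZ r l}
    (hY : Differentiable ℂ Y) : DifferentiableAt ℂ (fDx Y f) p :=
  (fDx_hasFDerivAt hf (hY p).hasFDerivAt).differentiableAt

theorem XT_diff (j) : Differentiable ℂ (XT j : fZ r l → fZ r l) := differentiable_const _
theorem XD_diff (a) : Differentiable ℂ (XD a : fZ r l → fZ r l) := (XD a).differentiable
theorem XE_diff : Differentiable ℂ (XE : fZ r l → fZ r l) := XE.differentiable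

theorem fDx_sub {f g : fZ r l → F} {p} (hf : DifferentiableAt ℂ f p) (hg : DifferentiableAt ℂ g p) (X) :
    fDx X (fun p => f p - g p) p = fDx X f p - fDx X g p := by
  rw [fDx, fderiv_fun_sub hf hg]; rfl

theorem fDx_add {f g : fZ r l → F} {p} (hf : DifferentiableAt ℂ f p) (hg : DifferentiableAt ℂ g p) (X) :
    fDx X (fun p => f p + g p) p = fDx X f p + fDx X g p := by
  rw [fDx, fderiv_fun_add hf hg]; rfl

theorem fDx_mul {A : Type*} [NormedRing A] [NormedAlgebra ℂ A] {f g : fZ r l → A} {p}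
    (hf : DifferentiableAt ℂ f p) (hg : DifferentiableAt ℂ g p) (X) :
    fDx X (fun p => f p * g p) p = fDx X f p * g p + f p * fDx X g p := by
  rw [fDx, fderiv_fun_mul' hf hg]
  simp [fDx, add_comm]

theorem fsnd_diff (j : Fin l) (p : fZ r l) :
    HasFDerivAt (fun p : fZ r l => p.2 j) ((ContinuousLinearMap.proj (R := ℂ) (φ := fun _ : Fin l => ℂ) j).comp (ContinuousLinearMap.snd ℂ (Fin r → ℂ) (Fin l → ℂ))) p :=
  ((ContinuousLinearMap.proj (R := ℂ) (φ := fun _ : Fin l => ℂ) j).comp (ContinuousLinearMap.snd ℂ (Fin r → ℂ) (Fin l → ℂ))).hasFDerivAt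

theorem fDx_tsum {f : Fin l → fZ r l → F} {p} (hf : ∀ j, DifferentiableAt ℂ (f j) p) (X) :
    fDx X (fun p => ∑ j, p.2 j • f j p) p = ∑ j, (p.2 j • fDx X (f j) p + (X p).2 j • f j p) := by
  have h := HasFDerivAt.fun_sum (u := Finset.univ) (x := p) (A := fun j p => p.2 j • f j p)
    (fun j _ => (fsnd_diff j p).smul (hf j).hasFDerivAt)
  rw [fDx, h.fderiv]
  simp [fDx, sum_apply]

theorem fDx_apply {V : Type*} [NormedAddCommGroup V] [NormedSpace ℂ V] {f : fZ r l → (V →L[ℂ] V)} {p}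
    (hf : DifferentiableAt ℂ f p) (X) (x : V) : fDx X (fun p => f p x) p = fDx X f p x := by
  have := hf.hasFDerivAt.clm_apply (hasFDerivAt_const x p)
  rw [fDx, this.fderiv]
  simp [fDx]

theorem fDx_const (c : F) (X : fZ r l → fZ r l) (p) : fDx X (fun _ => c) p = 0 := by
  simp [fDx]

theorem ford.fDx_XD {f : fZ r l → F} {k} (hf : fHol f) (ho : ford k f) (a : Fin r) :
    ford k (fDx (XD a) f) := by
  have h1 : ford 0 (fun p : fZ r l => p.1 a) := by
    apply fHol.ord0
    exact Eventually.of_forall fun p => by fun_prop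
  refine (h1.smul (ho.hderiv hf (Pi.single a 1))).congr (Eventually.of_forall fun p => ?_)
  simp [_root_.fDx_XD]

theorem fHol_of {G : Set (fZ r l)} (hG : IsOpen G) (h0 : (0 : fZ r l) ∈ G) {f : fZ r l → F}
    (h : ∀ p ∈ G, DifferentiableAt ℂ f p) : fHol f := by
  filter_upwards [hG.mem_nhds h0] with p hp using h p hp

end fields

section Tl

variable {r l : ℕ} {V : Type*} [NormedAddCommGroup V] [NormedSpace ℂ V] [FiniteDimensional ℂ V]
variable {n : ℕ} (L : Fin n → List (Fin r)) (b : Module.Basis (Fin n) ℂ V) (e : V)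

theorem ford.clm_apply {k} {f : fZ r l → (V →L[ℂ] V)} {g : fZ r l → V} (hf : ford 0 f) (hg : ford k g) :
    ford k (fun p => f p (g p)) := by
  have h := IsBigO.mul hf.norm_left hg.norm_left
  have h2 : (fun p => f p (g p)) =O[𝓝 0] fun p => ‖f p‖ * ‖g p‖ :=
    IsBigO.of_bound 1 (Eventually.of_forall fun p => by
      simpa using (f p).le_opNorm (g p))
  simpa [ford] using h2.trans h

theorem ford.clm_apply' {k} {f : fZ r l → (V →L[ℂ] V)} {g : fZ r l → V} (hf : ford k f) (hg : ford 0 g) :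
    ford k (fun p => f p (g p)) := by
  have h := IsBigO.mul hf.norm_left hg.norm_left
  have h2 : (fun p => f p (g p)) =O[𝓝 0] fun p => ‖f p‖ * ‖g p‖ :=
    IsBigO.of_bound 1 (Eventually.of_forall fun p => by
      simpa using (f p).le_opNorm (g p))
  simpa [ford] using h2.trans h

theorem ford_T {k} {u : Fin r → fZ r l → (V →L[ℂ] V)} (hu : ∀ a, fHol (u a))
    (hb : ∀ i, b i = ((L i).map (fun a => u a 0)).prod e) {Y : fZ r l → (V →L[ℂ] V)}
    (hY : ∀ i, ford k (fun p => Y p (((L i).map (fun a => u a p)).prod e))) : ford k Y := by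
  let T : fZ r l → (V →L[ℂ] V) := fun p => fT L b e (RingHom.id _) (fun a => u a p)
  have hT0 : T 0 = 1 := fT_one L b e hb
  have hTc : ContinuousAt T 0 := by
    refine ContinuousAt.comp (g := fT L b e (RingHom.id _)) (f := fun p a => u a p)
      (fT_contDiff L b e (RingHom.id _)).continuous.continuousAt ?_
    exact continuousAt_pi.2 fun a => (hu a).self_of_nhds.continuousAt
  have hTu : ∀ᶠ p in 𝓝 (0 : fZ r l), IsUnit (T p) :=
    hTc.eventually (Units.isOpen.mem_nhds (show IsUnit (T 0) by rw [hT0]; exact isUnit_one))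
  have hTi : ford 0 (fun p => Ring.inverse (T p)) := by
    have h1 : ContinuousAt (fun p => Ring.inverse (T p)) 0 := by
      have h2 : ContinuousAt Ring.inverse (T 0) := by
        have := NormedRing.inverse_continuousAt (1 : (V →L[ℂ] V)ˣ)
        rw [hT0]; simpa using this
      exact ContinuousAt.comp (g := Ring.inverse) h2 hTc
    simpa [ford] using! h1.isBigO_one ℝ
  have h3 : ford k (fun p => Y p * T p) := by
    have h4 : ford k (fun p => ∑ i, (fco b i).smulRight (Y p (((L i).map (fun a => u a p)).prod e))) := by
      refine ford.sum fun i _ => ?_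
      exact ((ContinuousLinearMap.smulRightL ℂ V V (fco b i)).isBigO_comp _ _).trans (hY i)
    refine h4.congr (Eventually.of_forall fun p => ?_)
    ext x
    simp [T, mul_apply_eq_comp, fT_apply, sum_apply, fco_apply]
  refine (h3.mul_right hTi).congr ?_
  filter_upwards [hTu] with p hp
  rw [mul_assoc, Ring.mul_inverse_cancel _ hp, mul_one]

end Tl




section idents

variable {r l : ℕ} {V : Type*} [NormedAddCommGroup V] [NormedSpace ℂ V] [FiniteDimensional ℂ V]
variable {n : ℕ} (L : Fin n → List (Fin r)) (b : Module.Basis (Fin n) ℂ V) (e : V) (v : Fin l → V)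

/-- words -/
noncomputable def fwd (M : List (Fin r)) (u : Fin r → fZ r l → (V →L[ℂ] V)) (p : fZ r l) : V →L[ℂ] V :=
  (M.map fun a => u a p).prod

theorem fwd_hol {u : Fin r → fZ r l → (V →L[ℂ] V)} (hu : ∀ a, fHol (u a)) (M : List (Fin r)) :
    fHol (fwd M u) := by
  filter_upwards [eventually_all.2 hu] with p hp
  refine DifferentiableAt.comp (g := fun u : Fin r → (V →L[ℂ] V) => (M.map u).prod)
    (f := fun p a => u a p) p ?_ (differentiableAt_pi.2 hp)
  exact ((fce_word_contDiff M).contDiffAt (x := fun a => u a p)).differentiableAt (by simp)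

theorem ford_comm_word {k} {u : Fin r → fZ r l → (V →L[ℂ] V)} (hu : ∀ a, fHol (u a))
    {Y : fZ r l → (V →L[ℂ] V)} (hY : ∀ a, ford k (fun p => Y p * u a p - u a p * Y p))
    (M : List (Fin r)) : ford k (fun p => Y p * fwd M u p - fwd M u p * Y p) := by
  induction M with
  | nil => exact ford_zero (Eventually.of_forall fun p => by simp [fwd])
  | cons a M ih =>
    refine (((hY a).mul_right (fwd_hol hu M).ord0).add ((hu a).ord0.mul_left ih)).congr
      (Eventually.of_forall fun p => ?_)
    simp only [fwd, List.map_cons, List.prod_cons]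
    noncomm_ring

theorem ford_word_sub {k} {u u' : Fin r → fZ r l → (V →L[ℂ] V)} (hu : ∀ a, fHol (u a))
    (hu' : ∀ a, fHol (u' a)) (h : ∀ a, ford k (fun p => u a p - u' a p))
    (M : List (Fin r)) : ford k (fun p => fwd M u p - fwd M u' p) := by
  induction M with
  | nil => exact ford_zero (Eventually.of_forall fun p => by simp [fwd])
  | cons a M ih =>
    refine (((h a).mul_right (fwd_hol hu M).ord0).add ((hu' a).ord0.mul_left ih)).congr
      (Eventually.of_forall fun p => ?_)
    simp only [fwd, List.map_cons, List.prod_cons]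
    noncomm_ring

variable {u : Fin r → fZ r l → (V →L[ℂ] V)} {φ : Fin l → fZ r l → (V →L[ℂ] V)}
  {G : Set (fZ r l)}

theorem XD_snd (a : Fin r) (p : fZ r l) (j : Fin l) : (XD a p).2 j = 0 := by
  simp [XD_apply]

theorem f_step_K (hG : IsOpen G) (h0 : (0 : fZ r l) ∈ G)
    (hu : ∀ a, ∀ p ∈ G, ContDiffAt ℂ 2 (u a) p) (hφ : ∀ j, ∀ p ∈ G, ContDiffAt ℂ 2 (φ j) p)
    (hE : ∀ a, ∀ p ∈ G, fDx XE (u a) p = ∑ j, p.2 j • fDx (XD a) (φ j) p)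
    (hK0 : ∀ a b, ∀ p ∈ G, p.2 = 0 → fDx (XD a) (u b) p = fDx (XD b) (u a) p) (a b) :
    ∀ᶠ p in 𝓝 (0 : fZ r l), fDx (XD a) (u b) p = fDx (XD b) (u a) p := by
  have hd : ∀ a b, ∀ p ∈ G, DifferentiableAt ℂ (fDx (XD a) (u b)) p :=
    fun a b p hp => fDx_diff (hu b p hp) (XD_diff a)
  have hh : fHol (fun p => fDx (XD a) (u b) p - fDx (XD b) (u a) p) :=
    fHol_of hG h0 fun p hp => (hd a b p hp).sub (hd b a p hp)
  have h2 : ∀ a b, ∀ p ∈ G, fDx XE (fDx (XD a) (u b)) p = ∑ j, p.2 j • fDx (XD a) (fDx (XD b) (φ j)) p := by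
    intro a b p hp
    rw [fDx_E_D (hu b p hp), fDx_congr hG (hE b) _ p hp,
      fDx_tsum (fun j => fDx_diff (hφ j p hp) (XD_diff b))]
    simp [XD_snd]
  have hz : ∀ᶠ p in 𝓝 (0 : fZ r l), fDx XE (fun p => fDx (XD a) (u b) p - fDx (XD b) (u a) p) p = 0 := by
    filter_upwards [hG.mem_nhds h0] with p hp
    rw [fDx_sub (hd a b p hp) (hd b a p hp), h2 a b p hp, h2 b a p hp, sub_eq_zero]
    exact Finset.sum_congr rfl fun j _ => by rw [fDx_D_D (hφ j p hp)]
  have := ford_eq_zero hh fun k => ford_of_euler hh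
    (by filter_upwards [hG.mem_nhds h0] with p hp h using sub_eq_zero.2 (hK0 a b p hp h)) (ford_zero hz)
  filter_upwards [this] with p hp using sub_eq_zero.1 hp

theorem f_step_C {s : Fin n → Fin l → fZ r l → ℂ} (hG : IsOpen G) (h0 : (0 : fZ r l) ∈ G)
    (hu : ∀ a, ∀ p ∈ G, ContDiffAt ℂ 2 (u a) p) (hφ : ∀ j, ∀ p ∈ G, ContDiffAt ℂ 2 (φ j) p)
    (hE : ∀ a, ∀ p ∈ G, fDx XE (u a) p = ∑ j, p.2 j • fDx (XD a) (φ j) p)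
    (hK : ∀ a b, ∀ p ∈ G, fDx (XD a) (u b) p = fDx (XD b) (u a) p)
    (hs : ∀ i j, ford 0 (s i j)) (hw : ∀ j, ∀ p ∈ G, φ j p = ∑ i, s i j p • fwd (L i) u p)
    (hC0 : ∀ a b, ∀ p ∈ G, p.2 = 0 → u a p * u b p = u b p * u a p) (a b) :
    ∀ᶠ p in 𝓝 (0 : fZ r l), u a p * u b p = u b p * u a p := by
  have hud : ∀ a, ∀ p ∈ G, DifferentiableAt ℂ (u a) p := fun a p hp => (hu a p hp).differentiableAt (by simp)
  have hφd : ∀ a, ∀ p ∈ G, DifferentiableAt ℂ (φ a) p := fun a p hp => (hφ a p hp).differentiableAt (by simp)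
  have hCd : ∀ a b, ∀ p ∈ G, DifferentiableAt ℂ (fun p => u a p * u b p - u b p * u a p) p :=
    fun a b p hp => ((hud a p hp).mul (hud b p hp)).sub ((hud b p hp).mul (hud a p hp))
  have hPd : ∀ j b, ∀ p ∈ G, DifferentiableAt ℂ (fun p => φ j p * u b p - u b p * φ j p) p :=
    fun a b p hp => ((hφd a p hp).mul (hud b p hp)).sub ((hud b p hp).mul (hφd a p hp))
  have hCh : ∀ a b, fHol (fun p => u a p * u b p - u b p * u a p) := fun a b => fHol_of hG h0 (hCd a b)
  have hPh : ∀ a b, fHol (fun p => φ a p * u b p - u b p * φ a p) := fun a b => fHol_of hG h0 (hPd a b)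
  have huh : ∀ a, fHol (u a) := fun a => fHol_of hG h0 (hud a)
  have hEC : ∀ a b, ∀ p ∈ G, fDx XE (fun p => u a p * u b p - u b p * u a p) p =
      ∑ j, p.2 j • (fDx (XD a) (fun p => φ j p * u b p - u b p * φ j p) p -
        fDx (XD b) (fun p => φ j p * u a p - u a p * φ j p) p) := by
    intro a b p hp
    rw [fDx_sub ((hud a p hp).fun_mul (hud b p hp)) ((hud b p hp).fun_mul (hud a p hp)),
      fDx_mul (hud a p hp) (hud b p hp), fDx_mul (hud b p hp) (hud a p hp), hE a p hp, hE b p hp]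
    simp only [Finset.sum_mul, Finset.mul_sum, ← Finset.sum_add_distrib, ← Finset.sum_sub_distrib]
    refine Finset.sum_congr rfl fun j _ => ?_
    rw [fDx_sub ((hφd j p hp).fun_mul (hud b p hp)) ((hud b p hp).fun_mul (hφd j p hp)),
      fDx_sub ((hφd j p hp).fun_mul (hud a p hp)) ((hud a p hp).fun_mul (hφd j p hp)),
      fDx_mul (hφd j p hp) (hud b p hp), fDx_mul (hud b p hp) (hφd j p hp),
      fDx_mul (hφd j p hp) (hud a p hp), fDx_mul (hud a p hp) (hφd j p hp), hK a b p hp]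
    simp only [smul_mul_assoc, mul_smul_comm, ← smul_add, ← smul_sub]
    congr 1
    abel
  have key : ∀ k, ∀ a b, ford k (fun p => u a p * u b p - u b p * u a p) := by
    intro k
    induction k with
    | zero => exact fun a b => (hCh a b).ord0
    | succ k ih =>
      have hP : ∀ j b, ford k (fun p => φ j p * u b p - u b p * φ j p) := by
        intro j b
        have h1 : ∀ i, ford k (fun p => fwd (L i) u p * u b p - u b p * fwd (L i) u p) := fun i =>
          (ford_comm_word huh (Y := u b) (fun a => ih b a) (L i)).neg.congr
            (Eventually.of_forall fun p => by simp)
        refine (ford.sum (s := Finset.univ) fun i _ => (hs i j).smul (h1 i)).congr ?_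
        filter_upwards [hG.mem_nhds h0] with p hp
        rw [hw j p hp]
        simp only [Finset.sum_mul, Finset.mul_sum, ← Finset.sum_sub_distrib, smul_mul_assoc, mul_smul_comm, smul_sub]
      intro a b
      refine ford_of_euler (hCh a b) ?_ ?_
      · filter_upwards [hG.mem_nhds h0] with p hp h using sub_eq_zero.2 (hC0 a b p hp h)
      · refine (ford.sum (s := Finset.univ) fun j _ => ford.tsmul j
          (((hP j b).fDx_XD (hPh j b) a).sub ((hP j a).fDx_XD (hPh j a) b))).congr ?_
        filter_upwards [hG.mem_nhds h0] with p hp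
        exact hEC a b p hp
  filter_upwards [ford_eq_zero (hCh a b) fun k => key _ a b] with p hp using sub_eq_zero.1 hp

theorem f_step_D (hG : IsOpen G) (h0 : (0 : fZ r l) ∈ G)
    (hu : ∀ a, ∀ p ∈ G, ContDiffAt ℂ 2 (u a) p) (hφ : ∀ j, ∀ p ∈ G, ContDiffAt ℂ 2 (φ j) p)
    (hE : ∀ a, ∀ p ∈ G, fDx XE (u a) p = ∑ j, p.2 j • fDx (XD a) (φ j) p)
    (hφu : ∀ j a, ∀ p ∈ G, φ j p * u a p = u a p * φ j p)
    (hφφ : ∀ j k, ∀ p ∈ G, φ j p * φ k p = φ k p * φ j p)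
    (hφe : ∀ j, ∀ p ∈ G, φ j p e = v j)
    (hb : ∀ i, b i = ((L i).map (fun a => u a 0)).prod e) :
    (∀ a j, ∀ᶠ p in 𝓝 (0 : fZ r l), fDx (XT j) (u a) p = fDx (XD a) (φ j) p) ∧
    (∀ j k, ∀ᶠ p in 𝓝 (0 : fZ r l), fDx (XT j) (φ k) p = fDx (XT k) (φ j) p) := by
  have hud : ∀ a, ∀ p ∈ G, DifferentiableAt ℂ (u a) p := fun a p hp => (hu a p hp).differentiableAt (by simp)
  have hφd : ∀ a, ∀ p ∈ G, DifferentiableAt ℂ (φ a) p := fun a p hp => (hφ a p hp).differentiableAt (by simp)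
  have huh : ∀ a, fHol (u a) := fun a => fHol_of hG h0 (hud a)
  have hφh : ∀ a, fHol (φ a) := fun a => fHol_of hG h0 (hφd a)
  have hDd : ∀ a j, ∀ p ∈ G, DifferentiableAt ℂ (fun p => fDx (XT j) (u a) p - fDx (XD a) (φ j) p) p :=
    fun a j p hp => (fDx_diff (hu a p hp) (XT_diff j)).sub (fDx_diff (hφ j p hp) (XD_diff a))
  have hBd : ∀ j k, ∀ p ∈ G, DifferentiableAt ℂ (fun p => fDx (XT j) (φ k) p - fDx (XT k) (φ j) p) p :=
    fun j k p hp => (fDx_diff (hφ k p hp) (XT_diff j)).sub (fDx_diff (hφ j p hp) (XT_diff k))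
  have hDh := fun a j => fHol_of hG h0 (hDd a j)
  have hBh := fun j k => fHol_of hG h0 (hBd j k)
  have hmul0 : ∀ (X : fZ r l → fZ r l) (f g : fZ r l → (V →L[ℂ] V)), (∀ p ∈ G, DifferentiableAt ℂ f p) →
      (∀ p ∈ G, DifferentiableAt ℂ g p) → (∀ p ∈ G, f p * g p = g p * f p) → ∀ p ∈ G,
      fDx X f p * g p + f p * fDx X g p = fDx X g p * f p + g p * fDx X f p := by
    intro X f g hf hg h p hp
    have := fDx_congr hG h X p hp
    rwa [fDx_mul (hf p hp) (hg p hp), fDx_mul (hg p hp) (hf p hp)] at this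
  -- commutator identity
  have hBu : ∀ j k a, ∀ p ∈ G,
      (fDx (XT j) (φ k) p - fDx (XT k) (φ j) p) * u a p - u a p * (fDx (XT j) (φ k) p - fDx (XT k) (φ j) p)
      = (φ j p * (fDx (XT k) (u a) p - fDx (XD a) (φ k) p) - (fDx (XT k) (u a) p - fDx (XD a) (φ k) p) * φ j p)
        - (φ k p * (fDx (XT j) (u a) p - fDx (XD a) (φ j) p) - (fDx (XT j) (u a) p - fDx (XD a) (φ j) p) * φ k p) := by
    intro j k a p hp
    have e1 := hmul0 (XT j) _ _ (hφd k) (hud a) (hφu k a) p hp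
    have e2 := hmul0 (XT k) _ _ (hφd j) (hud a) (hφu j a) p hp
    have e3 := hmul0 (XD a) _ _ (hφd j) (hφd k) (hφφ j k) p hp
    rw [← sub_eq_zero] at e1 e2 e3 ⊢
    rw [← sub_eq_zero.2 (e1.trans e2.symm), ← sub_eq_zero]
    rw [← e3]
    noncomm_ring
  have hBe : ∀ j k, ∀ p ∈ G, (fDx (XT j) (φ k) p - fDx (XT k) (φ j) p) e = 0 := by
    intro j k p hp
    have h1 : ∀ j k, fDx (XT j) (φ k) p e = 0 := by
      intro j k
      rw [← fDx_apply (hφd k p hp), fDx_congr hG (hφe k) _ p hp, fDx_const]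
    simp [h1]
  have hBD : ∀ k', (∀ a j, ford k' (fun p => fDx (XT j) (u a) p - fDx (XD a) (φ j) p)) →
      ∀ j k, ford k' (fun p => fDx (XT j) (φ k) p - fDx (XT k) (φ j) p) := by
    intro k' ih j k
    refine ford_T L b e huh hb fun i => ?_
    have h1 : ∀ a, ford k' (fun p => (fDx (XT j) (φ k) p - fDx (XT k) (φ j) p) * u a p -
        u a p * (fDx (XT j) (φ k) p - fDx (XT k) (φ j) p)) := by
      intro a
      refine ((((hφh j).ord0.mul_left (ih a k)).sub ((ih a k).mul_right (hφh j).ord0)).sub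
        (((hφh k).ord0.mul_left (ih a j)).sub ((ih a j).mul_right (hφh k).ord0))).congr ?_
      filter_upwards [hG.mem_nhds h0] with p hp using hBu j k a p hp
    have h2 := ford_comm_word huh h1 (L i)
    have h3 : ford 0 (fun _ : fZ r l => e) := fHol.ord0 (Eventually.of_forall fun p => by fun_prop)
    refine (h2.clm_apply' h3).congr ?_
    filter_upwards [hG.mem_nhds h0] with p hp
    have := hBe j k p hp
    generalize fDx (XT j) (φ k) p - fDx (XT k) (φ j) p = Y at this ⊢
    rw [sub_apply, mul_apply_eq_comp, mul_apply_eq_comp, this]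
    simp [fwd]
  have hED : ∀ a j, ∀ p ∈ G, fDx XE (fun p => fDx (XT j) (u a) p - fDx (XD a) (φ j) p) p +
      (fDx (XT j) (u a) p - fDx (XD a) (φ j) p) =
      ∑ k, p.2 k • fDx (XD a) (fun p => fDx (XT j) (φ k) p - fDx (XT k) (φ j) p) p := by
    intro a j p hp
    rw [fDx_sub (fDx_diff (hu a p hp) (XT_diff j)) (fDx_diff (hφ j p hp) (XD_diff a)), fDx_E_D (hφ j p hp)]
    have e1 := fDx_T_E (hu a p hp) j
    rw [fDx_congr hG (hE a) _ p hp, fDx_tsum (fun j => fDx_diff (hφ j p hp) (XD_diff a))] at e1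
    have e2 : fDx (XD a) (fDx XE (φ j)) p = ∑ k, p.2 k • fDx (XD a) (fDx (XT k) (φ j)) p := by
      rw [fDx_congr hG (fun p _ => fDx_XE (φ j) p) _ p hp,
        fDx_tsum (fun k => fDx_diff (hφ j p hp) (XT_diff k))]
      simp [XD_snd]
    have e3 : ∀ k, fDx (XD a) (fun p => fDx (XT j) (φ k) p - fDx (XT k) (φ j) p) p =
        fDx (XT j) (fDx (XD a) (φ k)) p - fDx (XD a) (fDx (XT k) (φ j)) p := by
      intro k
      rw [fDx_sub (fDx_diff (hφ k p hp) (XT_diff j)) (fDx_diff (hφ j p hp) (XT_diff k)), fDx_T_D (hφ k p hp)]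
    simp only [e3, smul_sub, Finset.sum_sub_distrib, ← e2]
    rw [Finset.sum_add_distrib] at e1
    have e4 : ∑ k, (XT j p).2 k • fDx (XD a) (φ k) p = fDx (XD a) (φ j) p := by
      simp [XT, Pi.single_apply]
    rw [e4] at e1
    rw [eq_sub_of_add_eq e1]
    abel
  have key : ∀ k, ∀ a j, ford k (fun p => fDx (XT j) (u a) p - fDx (XD a) (φ j) p) := by
    intro k'
    induction k' with
    | zero => exact fun a j => (hDh a j).ord0
    | succ k' ih =>
      intro a j
      refine ford_of_euler_one (hDh a j) ?_
      refine (ford.sum (s := Finset.univ) fun k _ => ford.tsmul k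
        ((hBD k' ih j k).fDx_XD (hBh j k) a)).congr ?_
      filter_upwards [hG.mem_nhds h0] with p hp
      exact hED a j p hp
  constructor
  · intro a j
    filter_upwards [ford_eq_zero (hDh a j) fun k => key _ a j] with p hp using sub_eq_zero.1 hp
  · intro j k
    filter_upwards [ford_eq_zero (hBh j k) fun k' => hBD _ (key _) j k] with p hp using sub_eq_zero.1 hp

end idents




section fin

variable {r l : ℕ} {V : Type*} [NormedAddCommGroup V] [NormedSpace ℂ V] [FiniteDimensional ℂ V]
variable {n : ℕ} (L : Fin n → List (Fin r)) (b : Module.Basis (Fin n) ℂ V) (e : V) (v : Fin l → V)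

theorem fwd_comm {u : Fin r → fZ r l → (V →L[ℂ] V)} {p} {Y : V →L[ℂ] V}
    (h : ∀ a, Y * u a p = u a p * Y) (M : List (Fin r)) : Y * fwd M u p = fwd M u p * Y := by
  induction M with
  | nil => simp [fwd]
  | cons a M ih =>
    simp only [fwd, List.map_cons, List.prod_cons] at ih ⊢
    rw [← mul_assoc, h, mul_assoc, ih, mul_assoc]

theorem f_unique {u u' : Fin r → fZ r l → (V →L[ℂ] V)} {φ φ' : Fin l → fZ r l → (V →L[ℂ] V)}
    {G : Set (fZ r l)} (hG : IsOpen G) (h0 : (0 : fZ r l) ∈ G)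
    (hud : ∀ a, ∀ p ∈ G, DifferentiableAt ℂ (u a) p) (hφd : ∀ j, ∀ p ∈ G, DifferentiableAt ℂ (φ j) p)
    (hud' : ∀ a, ∀ p ∈ G, DifferentiableAt ℂ (u' a) p) (hφd' : ∀ j, ∀ p ∈ G, DifferentiableAt ℂ (φ' j) p)
    (hi : ∀ a, ∀ p ∈ G, p.2 = 0 → u a p = u' a p)
    (hφe : ∀ j, ∀ p ∈ G, φ j p e = v j) (hφe' : ∀ j, ∀ p ∈ G, φ' j p e = v j)
    (hc : ∀ j a, ∀ p ∈ G, φ j p * u a p = u a p * φ j p)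
    (hc' : ∀ j a, ∀ p ∈ G, φ' j p * u' a p = u' a p * φ' j p)
    (hD : ∀ a j, ∀ p ∈ G, fDx (XT j) (u a) p = fDx (XD a) (φ j) p)
    (hD' : ∀ a j, ∀ p ∈ G, fDx (XT j) (u' a) p = fDx (XD a) (φ' j) p)
    (hb : ∀ i, b i = ((L i).map (fun a => u a 0)).prod e) :
    (∀ a, ∀ᶠ p in 𝓝 (0 : fZ r l), u a p = u' a p) ∧ (∀ j, ∀ᶠ p in 𝓝 (0 : fZ r l), φ j p = φ' j p) := by
  have huh : ∀ a, fHol (u a) := fun a => fHol_of hG h0 (hud a)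
  have hφh : ∀ a, fHol (φ a) := fun a => fHol_of hG h0 (hφd a)
  have huh' : ∀ a, fHol (u' a) := fun a => fHol_of hG h0 (hud' a)
  have hφh' : ∀ a, fHol (φ' a) := fun a => fHol_of hG h0 (hφd' a)
  have huu : ∀ a, fHol (fun p => u a p - u' a p) := fun a =>
    fHol_of hG h0 fun p hp => (hud a p hp).sub (hud' a p hp)
  have hφφ : ∀ a, fHol (fun p => φ a p - φ' a p) := fun a =>
    fHol_of hG h0 fun p hp => (hφd a p hp).sub (hφd' a p hp)
  have hcst : ∀ x : V, ford 0 (fun _ : fZ r l => x) := fun x =>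
    fHol.ord0 (Eventually.of_forall fun p => by fun_prop)
  have h1 : ∀ k, (∀ a, ford k (fun p => u a p - u' a p)) → ∀ j, ford k (fun p => φ j p - φ' j p) := by
    intro k ih j
    refine ford_T L b e huh hb fun i => ?_
    have hw := ford_word_sub huh huh' ih (L i)
    refine ((hw.clm_apply' (hcst (v j))).sub ((hφh' j).ord0.clm_apply (hw.clm_apply' (hcst e)))).congr ?_
    filter_upwards [hG.mem_nhds h0] with p hp
    have e1 := congrArg (fun T => T e) (fwd_comm (u := u) (p := p) (fun a => hc j a p hp) (L i))
    have e2 := congrArg (fun T => T e) (fwd_comm (u := u') (p := p) (fun a => hc' j a p hp) (L i))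
    simp only [mul_apply_eq_comp, hφe j p hp, hφe' j p hp] at e1 e2
    change (φ j p - φ' j p) (fwd (L i) u p e) = _
    rw [sub_apply, e1, sub_apply, sub_apply, map_sub, e2]
    abel
  have key : ∀ k, ∀ a, ford k (fun p => u a p - u' a p) := by
    intro k
    induction k with
    | zero => exact fun a => (huu a).ord0
    | succ k ih =>
      intro a
      refine ford_of_euler (huu a) ?_ ?_
      · filter_upwards [hG.mem_nhds h0] with p hp h using sub_eq_zero.2 (hi a p hp h)
      · refine (ford.sum (s := Finset.univ) fun j _ => ford.tsmul j
          ((h1 k ih j).fDx_XD (hφφ j) a)).congr ?_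
        filter_upwards [hG.mem_nhds h0] with p hp
        change fDx XE (fun p => u a p - u' a p) p = _
        rw [fDx_XE]
        refine Finset.sum_congr rfl fun j _ => ?_
        rw [fDx_sub (hud a p hp) (hud' a p hp), fDx_sub (hφd j p hp) (hφd' j p hp), hD a j p hp, hD' a j p hp]
  constructor
  · intro a
    filter_upwards [ford_eq_zero (huu a) fun k => key _ a] with p hp using sub_eq_zero.1 hp
  · intro j
    filter_upwards [ford_eq_zero (hφφ j) fun k => h1 _ (key _) j] with p hp using sub_eq_zero.1 hp

theorem f_shrink {P : fZ r l → Prop} (h : ∀ᶠ p in 𝓝 (0 : fZ r l), P p) :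
    ∃ G : Set (fZ r l), IsOpen G ∧ (0 : fZ r l) ∈ G ∧ ∀ p ∈ G, P p := by
  obtain ⟨G, h1, h2, h3⟩ := mem_nhds_iff.1 h
  exact ⟨G, h2, h3, h1⟩

theorem f_exists (U : Set (Fin r → ℂ)) (hU : IsOpen U) (h0U : (0 : Fin r → ℂ) ∈ U)
    (Ω : Fin r → (Fin r → ℂ) → (V →L[ℂ] V))
    (hΩhol : ∀ a, DifferentiableOn ℂ (Ω a) U)
    (hflat : ∀ a b, ∀ q ∈ U,
      q a • fderiv ℂ (Ω b) q (Pi.single a 1) = q b • fderiv ℂ (Ω a) q (Pi.single b 1))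
    (hcomm : ∀ a b, ∀ q ∈ U, Ω a q * Ω b q = Ω b q * Ω a q)
    (hb : ∀ i, b i = ((L i).map (fun a => Ω a 0)).prod e) :
    ∃ (G : Set (fZ r l)) (u : Fin r → fZ r l → (V →L[ℂ] V)) (φ : Fin l → fZ r l → (V →L[ℂ] V)),
      IsOpen G ∧ (0 : fZ r l) ∈ G ∧ (∀ p ∈ G, p.1 ∈ U) ∧
      (∀ a, ∀ p ∈ G, DifferentiableAt ℂ (u a) p) ∧ (∀ j, ∀ p ∈ G, DifferentiableAt ℂ (φ j) p) ∧
      (∀ a, ∀ p ∈ G, p.2 = 0 → u a p = Ω a p.1) ∧ (∀ j, ∀ p ∈ G, φ j p e = v j) ∧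
      (∀ a b, ∀ p ∈ G, u a p * u b p = u b p * u a p) ∧
      (∀ j a, ∀ p ∈ G, φ j p * u a p = u a p * φ j p) ∧
      (∀ j k, ∀ p ∈ G, φ j p * φ k p = φ k p * φ j p) ∧
      (∀ a j, ∀ p ∈ G, fDx (XT j) (u a) p = fDx (XD a) (φ j) p) ∧
      (∀ a b, ∀ p ∈ G, fDx (XD a) (u b) p = fDx (XD b) (u a) p) ∧
      (∀ j k, ∀ p ∈ G, fDx (XT j) (φ k) p = fDx (XT k) (φ j) p) := by
  obtain ⟨u, φ, s, c1, c2, c3, c4, c5, c6, c7⟩ := fCK L b e v U hU h0U Ω hΩhol hb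
  have hUe : ∀ᶠ p in 𝓝 (0 : fZ r l), p.1 ∈ U := continuousAt_fst.eventually (hU.mem_nhds h0U)
  obtain ⟨G, hG, h0, hP⟩ := f_shrink (hUe.and ((eventually_all.2 c1).and ((eventually_all.2 c2).and
    ((eventually_all.2 c3).and ((eventually_all.2 c4).and ((eventually_all.2 c5).and (eventually_all.2 c7)))))))
  have pU : ∀ p ∈ G, p.1 ∈ U := fun p hp => (hP p hp).1
  have hu : ∀ a, ∀ p ∈ G, ContDiffAt ℂ 2 (u a) p := fun a p hp => (hP p hp).2.1 a
  have hφ : ∀ a, ∀ p ∈ G, ContDiffAt ℂ 2 (φ a) p := fun a p hp => (hP p hp).2.2.1 a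
  have hi : ∀ a, ∀ p ∈ G, p.2 = 0 → u a p = Ω a p.1 := fun a p hp => (hP p hp).2.2.2.1 a
  have he : ∀ j, ∀ p ∈ G, φ j p e = v j := fun a p hp => (hP p hp).2.2.2.2.1 a
  have hw : ∀ j, ∀ p ∈ G, φ j p = ∑ i, s i j p • fwd (L i) u p := fun a p hp => (hP p hp).2.2.2.2.2.1 a
  have hE : ∀ a, ∀ p ∈ G, fDx XE (u a) p = ∑ j, p.2 j • fDx (XD a) (φ j) p := by
    intro a p hp
    have := (hP p hp).2.2.2.2.2.2 a
    simp only [fDx_XD]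
    exact this
  have hs : ∀ i j, ford 0 (s i j) := fun i j => by simpa [ford] using c6 i j
  have hu0 : ∀ a, u a 0 = Ω a 0 := fun a => hi a 0 h0 rfl
  have hb' : ∀ i, b i = ((L i).map (fun a => u a 0)).prod e := by simpa only [hu0] using hb
  have hr : ∀ a b, ∀ p ∈ G, p.2 = 0 → fDx (XD a) (u b) p = p.1 a • fderiv ℂ (Ω b) p.1 (Pi.single a 1) := by
    intro a b p hp h
    rw [fDx_XD]
    congr 1
    have h1 : HasFDerivAt (fun q : Fin r → ℂ => ((q, 0) : fZ r l)) (ContinuousLinearMap.inl ℂ _ _) p.1 :=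
      (ContinuousLinearMap.inl ℂ (Fin r → ℂ) (Fin l → ℂ)).hasFDerivAt
    have hpp : ((p.1, 0) : fZ r l) = p := by rw [← h]
    have h2 : HasFDerivAt (u b) (fderiv ℂ (u b) p) ((p.1, 0) : fZ r l) := by
      rw [hpp]; exact ((hu b p hp).differentiableAt (by simp)).hasFDerivAt
    have h3 := h2.comp p.1 h1
    have h4 : (u b ∘ fun q : Fin r → ℂ => ((q, 0) : fZ r l)) =ᶠ[𝓝 p.1] Ω b := by
      have : ∀ᶠ q in 𝓝 p.1, ((q, 0) : fZ r l) ∈ G :=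
        h1.continuousAt.eventually (hG.mem_nhds (by rwa [← hpp] at hp))
      filter_upwards [this] with q hq using hi b _ hq rfl
    rw [← h4.fderiv_eq, h3.fderiv]
    simp
  have hK0 : ∀ a b, ∀ p ∈ G, p.2 = 0 → fDx (XD a) (u b) p = fDx (XD b) (u a) p := by
    intro a b p hp h
    rw [hr a b p hp h, hr b a p hp h, hflat a b _ (pU p hp)]
  have hC0 : ∀ a b, ∀ p ∈ G, p.2 = 0 → u a p * u b p = u b p * u a p := by
    intro a b p hp h
    rw [hi a p hp h, hi b p hp h, hcomm a b _ (pU p hp)]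
  -- step K
  obtain ⟨G1, hG1, h01, hP1⟩ := f_shrink ((hG.eventually_mem h0).and
    (eventually_all.2 fun a => eventually_all.2 fun b => f_step_K hG h0 hu hφ hE hK0 a b))
  have s1 : ∀ p ∈ G1, p ∈ G := fun p hp => (hP1 p hp).1
  have hK : ∀ a b, ∀ p ∈ G1, fDx (XD a) (u b) p = fDx (XD b) (u a) p := fun a b p hp => (hP1 p hp).2 a b
  -- step C
  obtain ⟨G2, hG2, h02, hP2⟩ := f_shrink ((hG1.eventually_mem h01).and
    (eventually_all.2 fun a => eventually_all.2 fun b => f_step_C L hG1 h01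
      (fun a p hp => hu a p (s1 p hp)) (fun a p hp => hφ a p (s1 p hp)) (fun a p hp => hE a p (s1 p hp)) hK hs
      (fun j p hp => hw j p (s1 p hp)) (fun a b p hp => hC0 a b p (s1 p hp)) a b))
  have s2 : ∀ p ∈ G2, p ∈ G := fun p hp => s1 p (hP2 p hp).1
  have huu : ∀ a b, ∀ p ∈ G2, u a p * u b p = u b p * u a p := fun a b p hp => (hP2 p hp).2 a b
  have hφY : ∀ j, ∀ p ∈ G2, ∀ Y : V →L[ℂ] V, (∀ a, Y * u a p = u a p * Y) → φ j p * Y = Y * φ j p := by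
    intro j p hp Y hY
    rw [hw j p (s2 p hp)]
    simp only [Finset.sum_mul, Finset.mul_sum, smul_mul_assoc, mul_smul_comm, fwd_comm hY]
  have hφu : ∀ j a, ∀ p ∈ G2, φ j p * u a p = u a p * φ j p := fun j a p hp =>
    hφY j p hp _ fun a' => huu a a' p hp
  have hφφ : ∀ j k, ∀ p ∈ G2, φ j p * φ k p = φ k p * φ j p := fun j k p hp =>
    hφY j p hp _ fun a' => hφu k a' p hp
  -- step D
  obtain ⟨d1, d2⟩ := f_step_D L b e v hG2 h02
      (fun a p hp => hu a p (s2 p hp)) (fun a p hp => hφ a p (s2 p hp)) (fun a p hp => hE a p (s2 p hp))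
      hφu hφφ (fun j p hp => he j p (s2 p hp)) hb'
  obtain ⟨G3, hG3, h03, hP3⟩ := f_shrink ((hG2.eventually_mem h02).and
    ((eventually_all.2 fun a => eventually_all.2 fun j => d1 a j).and
      (eventually_all.2 fun j => eventually_all.2 fun k => d2 j k)))
  have s3 : ∀ p ∈ G3, p ∈ G2 := fun p hp => (hP3 p hp).1
  have s4 : ∀ p ∈ G3, p ∈ G := fun p hp => s2 p (s3 p hp)
  exact ⟨G3, u, φ, hG3, h03, fun p hp => pU p (s4 p hp),
    fun a p hp => (hu a p (s4 p hp)).differentiableAt (by simp),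
    fun a p hp => (hφ a p (s4 p hp)).differentiableAt (by simp),
    fun a p hp => hi a p (s4 p hp), fun j p hp => he j p (s4 p hp),
    fun a b p hp => huu a b p (s3 p hp), fun j a p hp => hφu j a p (s3 p hp),
    fun j k p hp => hφφ j k p (s3 p hp), fun a j p hp => (hP3 p hp).2.1 a j,
    fun a b p hp => hK a b p (hP2 p (s3 p hp)).1, fun j k p hp => (hP3 p hp).2.2 j k⟩

end fin

end aux_proof

/-- reconstruction of big quantum connections. A flat pencil of connections
`ℏ d + ∑_a Ω_a dq_a/q_a` with holomorphic `ℏ`-independent connection matrices on a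
neighborhood `U` of `0 ∈ ℂ^r`, whose fiber `V` is generated by `e` under the residue
endomorphisms `p_a = Ω_a(0)`, extends — holomorphically, and uniquely as a germ at `0` — to a
flat pencil on a neighborhood of `0 ∈ ℂ^{r+l}` in the directions `t₁, …, t_l`, subject to
`Φ_j(q,t) e = v_j`. -/
theorem flat_connection_extension (r l : ℕ) (V : Type*) [NormedAddCommGroup V]
    [NormedSpace ℂ V] [FiniteDimensional ℂ V] (e : V) (v : Fin l → V)
    (U : Set (Fin r → ℂ)) (hU : IsOpen U) (h0U : (0 : Fin r → ℂ) ∈ U)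
    (Ω : Fin r → (Fin r → ℂ) → (V →L[ℂ] V))
    (hΩhol : ∀ a, DifferentiableOn ℂ (Ω a) U)
    (hflat : ∀ a b, ∀ q ∈ U,
      q a • fderiv ℂ (Ω b) q (Pi.single a 1) = q b • fderiv ℂ (Ω a) q (Pi.single b 1))
    (hcomm : ∀ a b, ∀ q ∈ U, Ω a q * Ω b q = Ω b q * Ω a q)
    (hspan : Submodule.span ℂ
      {w : V | ∃ L : List (Fin r), w = L.foldr (fun a x => Ω a 0 x) e} = ⊤) :
    ∃ (U' : Set ((Fin r → ℂ) × (Fin l → ℂ)))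
      (Ωt : Fin r → ((Fin r → ℂ) × (Fin l → ℂ)) → (V →L[ℂ] V))
      (Φ : Fin l → ((Fin r → ℂ) × (Fin l → ℂ)) → (V →L[ℂ] V)),
      IsFlatExtension r l V e v U Ω U' Ωt Φ ∧
      ∀ (U'' : Set ((Fin r → ℂ) × (Fin l → ℂ)))
        (Ωt' : Fin r → ((Fin r → ℂ) × (Fin l → ℂ)) → (V →L[ℂ] V))
        (Φ' : Fin l → ((Fin r → ℂ) × (Fin l → ℂ)) → (V →L[ℂ] V)),
        IsFlatExtension r l V e v U Ω U'' Ωt' Φ' →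
        ∃ W : Set ((Fin r → ℂ) × (Fin l → ℂ)), IsOpen W ∧
          ((0 : Fin r → ℂ), (0 : Fin l → ℂ)) ∈ W ∧
          ∀ p ∈ W, (∀ a, Ωt a p = Ωt' a p) ∧ (∀ j, Φ j p = Φ' j p) := by
  obtain ⟨n, L, b, hb⟩ := fce_basis (fun a => Ω a 0) e hspan
  obtain ⟨G, u, φ, hG, h0, pU, hu, hφ, hi, he, huu, hφu, hφφ, hD, hK, hB⟩ :=
    f_exists L b e v U hU h0U Ω hΩhol hflat hcomm hb
  refine ⟨G, u, φ, ⟨hG, h0, pU, fun a p hp => (hu a p hp).differentiableWithinAt,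
    fun a p hp => (hφ a p hp).differentiableWithinAt, fun a q hq => hi a _ hq rfl, he, huu,
    fun a j p hp => (hφu j a p hp).symm, hφφ, fun a j p hp => ?_, fun a b p hp => ?_,
    fun j k p hp => hB j k p hp⟩, ?_⟩
  · have := hD a j p hp
    rw [fDx_XD] at this
    exact this
  · have := hK a b p hp
    rwa [fDx_XD, fDx_XD] at this
  · rintro U'' u' φ' ⟨hG', h0', pU', hu', hφ', hi', he', huu', huφ', hφφ', hD', hK', hB'⟩
    have hb' : ∀ i, b i = ((L i).map (fun a => u a 0)).prod e := by
      have hu0 : ∀ a, u a 0 = Ω a 0 := fun a => hi a 0 h0 rfl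
      simpa only [hu0] using hb
    obtain ⟨k1, k2⟩ := f_unique L b e v (u := u) (u' := u') (φ := φ) (φ' := φ')
      (G := G ∩ U'') (hG.inter hG') ⟨h0, h0'⟩
      (fun a p hp => hu a p hp.1) (fun a p hp => hφ a p hp.1)
      (fun a p hp => (hu' a).differentiableAt (hG'.mem_nhds hp.2))
      (fun a p hp => (hφ' a).differentiableAt (hG'.mem_nhds hp.2))
      (fun a p hp h => by
        obtain ⟨q, t⟩ := p
        obtain rfl : t = 0 := h
        rw [hi a _ hp.1 rfl, hi' a q hp.2])
      (fun j p hp => he j p hp.1) (fun j p hp => he' j p hp.2)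
      (fun j a p hp => hφu j a p hp.1) (fun j a p hp => (huφ' a j p hp.2).symm)
      (fun a j p hp => hD a j p hp.1)
      (fun a j p hp => by
        rw [fDx_XD]
        exact hD' a j p hp.2) hb'
    obtain ⟨W, hW, h0W, hWP⟩ := f_shrink
      ((Filter.eventually_all.2 k1).and (Filter.eventually_all.2 k2))
    exact ⟨W, hW, h0W, hWP⟩
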